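/- arXiv:1704.05896 — 2 statements merged into one kernel-verified Lean document; each statement's English description precedes it below -/
import Mathlib

section
/- For every solution P = (E_P, λ_P) of the instance I' and all 1 ≤ j < q ≤ k, P cuts exactly one edge r r_e between the root r of T and the root r_e of an edge-gadget T_e corresponding to an edge e of M between a vertex of color class C_j and a vertex of color class C_q; moreover, λ_P assigns a substar of the star S_e of T_e to group G_j^q. -/
namespace MCC

/-- `k₀ = k + C(k,2)`. -/
def k0 (k : ℕ) : ℕ := k + Nat.choose k 2

/-- `K = k + 3·C(k,2)`, the cut budget. -/
def KK (k : ℕ) : ℕ := k + 3 * Nat.choose k 2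

/-- `z = k₀² · n⁵`. -/
def z (k n : ℕ) : ℕ := (k0 k)^2 * n^5

/-- `b_j = k₀^{2j} · z` (`j` is 1-based). -/
def bb (k n j : ℕ) : ℕ := (k0 k)^(2*j) * z k n

/-- `c_j = k₀^{2(k+j)} · z` (`j` is 1-based). -/
def cc (k n j : ℕ) : ℕ := (k0 k)^(2*(k+j)) * z k n

/-- `c_j^q = c_k · k₀^{2((j−1)k − j(j−1)/2 + q − j)}` (`j, q` are 1-based, `j < q`). -/
def cjq (k n j q : ℕ) : ℕ := cc k n k * (k0 k)^(2*((j-1)*k - j*(j-1)/2 + q - j))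

/-- The number of vertices of each copy of the star `S_fix`: `c_{k−1}^k + K + 1`. -/
def fixSize (k n : ℕ) : ℕ := cjq k n (k-1) k + KK k + 1

/-- The number of vertices of the vertex-gadget star `S_{v_i^j}`:
`c_j − (k−1)·b_j − (k−1)·x_i`, for the vertex `v = (j, i)`. -/
def vgSize (k n : ℕ) (x : Fin n → ℕ) (v : Fin k × Fin n) : ℕ :=
  cc k n (v.1.1 + 1) - (k-1) * bb k n (v.1.1 + 1) - (k-1) * x v.2

/-- The number of vertices of the star `S'_{v_i^j}`: `b_j + x_i`, for the vertex `v = (j, i)`. -/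
def spSize (k n : ℕ) (x : Fin n → ℕ) (v : Fin k × Fin n) : ℕ := bb k n (v.1.1 + 1) + x v.2

/-- Index type for the edges of `M`: ordered pairs of adjacent vertices, with the endpoint of
smaller color first. Each edge of `M` appears exactly once (the coloring being proper). -/
def EIdx (k n : ℕ) (M : SimpleGraph (Fin k × Fin n)) : Type :=
  {p : (Fin k × Fin n) × (Fin k × Fin n) // M.Adj p.1 p.2 ∧ p.1.1 < p.2.1}

/-- The number of vertices of the star `S_e` of the edge-gadget `T_e`: `c_j^q` for an edge `e`
between color classes `j < q`. -/
def seSize (k n : ℕ) {M : SimpleGraph (Fin k × Fin n)} (e : EIdx k n M) : ℕ :=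
  cjq k n (e.1.1.1.1 + 1) (e.1.2.1.1 + 1)

/-- The vertex type of the tree `T` of the instance `I'`: the root `r` (the `Unit` summand);
for each vertex `v` of `M` the star `S_v` (root `none`, leaves `some _`); for each edge `e`
of `M` the edge-gadget `T_e` consisting of the star `S_e` and the two stars `S'` attached to
its two endpoints; and `K+1` copies of the star `S_fix`. -/
abbrev VV (k n : ℕ) (x : Fin n → ℕ) (M : SimpleGraph (Fin k × Fin n)) : Type :=
  Unit ⊕
  (Σ v : Fin k × Fin n, Option (Fin (vgSize k n x v - 1))) ⊕
  (Σ e : EIdx k n M,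
    (Option (Fin (seSize k n e - 1)) ⊕ Option (Fin (spSize k n x e.1.1 - 1)) ⊕
      Option (Fin (spSize k n x e.1.2 - 1)))) ⊕
  (Fin (KK k + 1) × Option (Fin (fixSize k n - 1)))

/-- Classify a vertex of an edge-gadget: which of the three stars it belongs to
(`0` for `S_e`, `1` and `2` for the two `S'`-stars) and whether it is that star's root. -/
def code {A B C : Type} : (Option A ⊕ Option B ⊕ Option C) → ℕ × Bool
  | Sum.inl none => (0, true)
  | Sum.inl (some _) => (0, false)
  | Sum.inr (Sum.inl none) => (1, true)
  | Sum.inr (Sum.inl (some _)) => (1, false)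
  | Sum.inr (Sum.inr none) => (2, true)
  | Sum.inr (Sum.inr (some _)) => (2, false)

/-- Adjacency inside an edge-gadget `T_e`: the root `r_e` of `S_e` is joined to the leaves of
`S_e` and to the roots of the two `S'`-stars, and the root of each `S'`-star is joined to
its leaves. -/
def codeRel : ℕ × Bool → ℕ × Bool → Prop
  | (0, true), (0, false) => True
  | (0, true), (1, true) => True
  | (0, true), (2, true) => True
  | (1, true), (1, false) => True
  | (2, true), (2, false) => True
  | _, _ => False

/-- The (directed) edge relation of the tree `T` of the instance `I'`. -/
def relMCC (k n : ℕ) (x : Fin n → ℕ) (M : SimpleGraph (Fin k × Fin n)) :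
    VV k n x M → VV k n x M → Prop
  | Sum.inl _, Sum.inr (Sum.inl ⟨_, d⟩) => d = none
  | Sum.inr (Sum.inl ⟨u, d⟩), Sum.inr (Sum.inl ⟨u', d'⟩) => u = u' ∧ d = none ∧ d' ≠ none
  | Sum.inl _, Sum.inr (Sum.inr (Sum.inl ⟨_, d⟩)) => code d = (0, true)
  | Sum.inr (Sum.inr (Sum.inl ⟨e, d⟩)), Sum.inr (Sum.inr (Sum.inl ⟨e', d'⟩)) =>
      e = e' ∧ codeRel (code d) (code d')
  | Sum.inl _, Sum.inr (Sum.inr (Sum.inr (_, d))) => d = none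
  | Sum.inr (Sum.inr (Sum.inr (c, d))), Sum.inr (Sum.inr (Sum.inr (c', d'))) =>
      c = c' ∧ d = none ∧ d' ≠ none
  | _, _ => False

/-- The tree `T` of the instance `I'`. -/
def TG (k n : ℕ) (x : Fin n → ℕ) (M : SimpleGraph (Fin k × Fin n)) : SimpleGraph (VV k n x M) :=
  SimpleGraph.fromRel (relMCC k n x M)

/-- The root `r` of `T`. -/
def rootT (k n : ℕ) (x : Fin n → ℕ) (M : SimpleGraph (Fin k × Fin n)) : VV k n x M :=
  Sum.inl ()

/-- The root `r_{v_i^j}` of the vertex-gadget star `S_{v_i^j}`. -/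
def vgRoot (k n : ℕ) (x : Fin n → ℕ) (M : SimpleGraph (Fin k × Fin n)) (v : Fin k × Fin n) :
    VV k n x M :=
  Sum.inr (Sum.inl ⟨v, none⟩)

/-- The root `r_e` of the star `S_e` of the edge-gadget `T_e`. -/
def seRoot (k n : ℕ) (x : Fin n → ℕ) {M : SimpleGraph (Fin k × Fin n)} (e : EIdx k n M) :
    VV k n x M :=
  Sum.inr (Sum.inr (Sum.inl ⟨e, Sum.inl none⟩))

/-- The root `r'_{v_i^j}` of the star `S'` of the lower-colored endpoint of `e`. -/
def sp1Root (k n : ℕ) (x : Fin n → ℕ) {M : SimpleGraph (Fin k × Fin n)} (e : EIdx k n M) :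
    VV k n x M :=
  Sum.inr (Sum.inr (Sum.inl ⟨e, Sum.inr (Sum.inl none)⟩))

/-- The root `r'_{v_p^q}` of the star `S'` of the higher-colored endpoint of `e`. -/
def sp2Root (k n : ℕ) (x : Fin n → ℕ) {M : SimpleGraph (Fin k × Fin n)} (e : EIdx k n M) :
    VV k n x M :=
  Sum.inr (Sum.inr (Sum.inl ⟨e, Sum.inr (Sum.inr none)⟩))

/-- The vertex set of the vertex-gadget star `S_v`. -/
def vgSet (k n : ℕ) (x : Fin n → ℕ) (M : SimpleGraph (Fin k × Fin n)) (v : Fin k × Fin n) :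
    Set (VV k n x M) :=
  {w | ∃ d, w = Sum.inr (Sum.inl ⟨v, d⟩)}

/-- The vertex set of the star `S_e` of the edge-gadget `T_e`. -/
def SeSet (k n : ℕ) (x : Fin n → ℕ) {M : SimpleGraph (Fin k × Fin n)} (e : EIdx k n M) :
    Set (VV k n x M) :=
  {w | ∃ d, w = Sum.inr (Sum.inr (Sum.inl ⟨e, Sum.inl d⟩))}

/-- The groups of the instance `I'`: the groups `G_1, …, G_k`, the groups `G_j^q` for
`1 ≤ j < q ≤ k`, and the group `G_rest`. -/
abbrev Grp (k : ℕ) : Type := Fin k ⊕ {pq : Fin k × Fin k // pq.1 < pq.2} ⊕ Unit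

/-- The group `G_j`. -/
def gCol {k : ℕ} (j : Fin k) : Grp k := Sum.inl j

/-- The group `G_j^q`. -/
def gPair {k : ℕ} (pq : {pq : Fin k × Fin k // pq.1 < pq.2}) : Grp k := Sum.inr (Sum.inl pq)

/-- The group `G_rest`. -/
def gRest (k : ℕ) : Grp k := Sum.inr (Sum.inr ())

/-- `t = |V(T)|`. -/
noncomputable def tTot (k n : ℕ) (x : Fin n → ℕ) (M : SimpleGraph (Fin k × Fin n)) : ℕ :=
  (Set.univ : Set (VV k n x M)).ncard

/-- `t' = t − Σ_j c_j − Σ_{j<q} c_j^q`, the size of the group `G_rest`. -/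
noncomputable def tRest (k n : ℕ) (x : Fin n → ℕ) (M : SimpleGraph (Fin k × Fin n)) : ℕ :=
  tTot k n x M - (∑ j : Fin k, cc k n (j.1 + 1)) -
    ∑ pq : {pq : Fin k × Fin k // pq.1 < pq.2}, cjq k n (pq.1.1.1 + 1) (pq.1.2.1 + 1)

/-- The prescribed sizes of the groups: `G_j` has size `c_j`, `G_j^q` has size `c_j^q`,
and `G_rest` has size `t'`. -/
noncomputable def sizesMCC (k n : ℕ) (x : Fin n → ℕ) (M : SimpleGraph (Fin k × Fin n)) :
    Grp k → ℕ
  | Sum.inl j => cc k n (j.1 + 1)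
  | Sum.inr (Sum.inl pq) => cjq k n (pq.1.1.1 + 1) (pq.1.2.1 + 1)
  | Sum.inr (Sum.inr _) => tRest k n x M

/-- A solution cutting at most `kk` edges: `EP` is a set of at most `kk` edges of `T`, and
`lam` assigns the connected components of `T − EP` to the groups (it is constant on each
component) so that each group `g` receives exactly `sizes g` vertices. -/
def IsSolutionLe {V G : Type} (T : SimpleGraph V) (EP : Set (Sym2 V)) (kk : ℕ)
    (sizes : G → ℕ) (lam : V → G) : Prop :=
  EP ⊆ T.edgeSet ∧ EP.ncard ≤ kk ∧
    (∀ v w : V, (T.deleteEdges EP).Reachable v w → lam v = lam w) ∧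
    ∀ g : G, {v | lam v = g}.ncard = sizes g

/-- `C` is a `P`-component: a connected component of `T − EP`. -/
def IsPComp {V : Type} (T : SimpleGraph V) (EP : Set (Sym2 V)) (C : Set V) : Prop :=
  ∃ v : V, C = {w | (T.deleteEdges EP).Reachable v w}

/-- `M` contains a multicolored `k`-clique: one vertex of each color class, pairwise adjacent. -/
def HasMCClique (k n : ℕ) (M : SimpleGraph (Fin k × Fin n)) : Prop :=
  ∃ sel : Fin k → Fin n, ∀ j j' : Fin k, j ≠ j' → M.Adj (j, sel j) (j', sel j')

/-- The instance `I'` has a solution. -/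
def HasSol (k n : ℕ) (x : Fin n → ℕ) (M : SimpleGraph (Fin k × Fin n)) : Prop :=
  ∃ (EP : Set (Sym2 (VV k n x M))) (lam : VV k n x M → Grp k),
    IsSolutionLe (TG k n x M) EP (KK k) (sizesMCC k n x M) lam

end MCC

open MCC


namespace MCCP

theorem k0_ge {k : ℕ} (hk : 2 ≤ k) : 3 ≤ k0 k := by
  have : 0 < Nat.choose k 2 := Nat.choose_pos hk
  unfold k0; omega

theorem KK_le {k : ℕ} (hk : 2 ≤ k) : KK k + 4 ≤ k0 k ^ 2 := by
  have h3 := k0_ge hk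
  have h : KK k + 4 ≤ 3 * k0 k := by unfold KK k0; omega
  nlinarith

theorem k_le_k0 (k : ℕ) : k ≤ k0 k := by unfold k0; omega

theorem z_ge {k n : ℕ} (hk : 2 ≤ k) (hn : 1 ≤ n) : n ^ 4 ≤ z k n ∧ KK k + 4 ≤ z k n ∧ KK k * n^4 ≤ z k n := by
  have h1 := KK_le hk
  have h2 : n ^ 4 ≤ n ^ 5 := Nat.pow_le_pow_right hn (by norm_num)
  have h3 : 1 ≤ n ^ 5 := Nat.one_le_pow _ _ hn
  unfold z
  refine ⟨by nlinarith, by nlinarith, ?_⟩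
  exact Nat.mul_le_mul (by omega) h2

theorem kpow {k : ℕ} (hk : 2 ≤ k) (i : ℕ) : 1 ≤ k0 k ^ i :=
  Nat.one_le_pow _ _ (by have := k0_ge hk; omega)

theorem bb_ge {k n : ℕ} (hk : 2 ≤ k) (j : ℕ) : z k n ≤ bb k n j := by
  unfold bb; exact Nat.le_mul_of_pos_left _ (kpow hk _)

theorem bb_mono {k n : ℕ} (hk : 2 ≤ k) {i j : ℕ} (h : i ≤ j) : bb k n i ≤ bb k n j := by
  unfold bb
  exact Nat.mul_le_mul_right _ (Nat.pow_le_pow_right (by have := k0_ge hk; omega) (by omega))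

theorem cc_mono {k n : ℕ} (hk : 2 ≤ k) {i j : ℕ} (h : i ≤ j) : cc k n i ≤ cc k n j := by
  unfold cc
  exact Nat.mul_le_mul_right _ (Nat.pow_le_pow_right (by have := k0_ge hk; omega) (by omega))

theorem cc_succ (k n j : ℕ) : cc k n (j+1) = k0 k ^ 2 * cc k n j := by
  unfold cc; ring

theorem cc_zero (k n : ℕ) : cc k n 0 = bb k n k := by
  unfold cc bb; ring_nf

theorem cc_bb (k n j : ℕ) : cc k n j = k0 k ^ (2*k) * bb k n j := by
  unfold cc bb; ring

theorem k0sq_le {k : ℕ} (hk : 2 ≤ k) : k0 k ^ 2 * k0 k ^ 2 ≤ k0 k ^ (2*k) := by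
  rw [← pow_add]; exact Nat.pow_le_pow_right (by have := k0_ge hk; omega) (by omega)

theorem numA {k n : ℕ} (hk : 2 ≤ k) (hn : 1 ≤ n) (i : ℕ) :
    KK k * (cc k n k * k0 k ^ (2*i) + 4 * bb k n k) < cc k n k * k0 k ^ (2*(i+1)) := by
  have h1 := KK_le hk
  have hz := z_ge hk hn
  have hb := bb_ge (n := n) hk k
  have hp := kpow hk (2*i)
  have h2 : k0 k ^ (2*(i+1)) = k0 k ^ (2*i) * k0 k ^ 2 := by ring
  have h3 : k0 k ^ 2 ≤ k0 k ^ (2*k) := Nat.pow_le_pow_right (by have := k0_ge hk; omega) (by omega)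
  have h4 : KK k * bb k n k < cc k n k := by
    rw [cc_bb]; exact Nat.mul_lt_mul_of_pos_right (by omega) (by omega)
  have h5 : cc k n k ≤ cc k n k * k0 k ^ (2*i) := Nat.le_mul_of_pos_right _ hp
  rw [h2, ← mul_assoc]
  set c := cc k n k * k0 k ^ (2*i)
  have : c * (KK k + 4) ≤ c * k0 k ^ 2 := Nat.mul_le_mul_left _ h1
  nlinarith

theorem numB {k n : ℕ} (hk : 2 ≤ k) (hn : 1 ≤ n) (i : ℕ) :
    KK k * (cc k n i + n^4) < cc k n (i+1) := by
  have h1 := KK_le hk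
  have hz := z_ge hk hn
  have hb := bb_ge (n := n) hk k
  have hc := cc_mono (n := n) hk (Nat.zero_le i)
  rw [cc_zero] at hc
  rw [cc_succ]
  have : (KK k + 4) * cc k n i ≤ k0 k ^ 2 * cc k n i := Nat.mul_le_mul_right _ h1
  nlinarith

theorem numC0 {k n : ℕ} (hk : 2 ≤ k) (hn : 1 ≤ n) {c : ℕ} (hc : cc k n 0 ≤ c) :
    c + KK k < c * k0 k ^ 2 := by
  have h1 := KK_le hk
  have hz := z_ge hk hn
  have hb := bb_ge (n := n) hk k
  rw [cc_zero] at hc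
  have : c * (KK k + 4) ≤ c * k0 k ^ 2 := Nat.mul_le_mul_left _ h1
  nlinarith

theorem numC {k n : ℕ} (hk : 2 ≤ k) (hn : 1 ≤ n) {i i' : ℕ} (h : i < i') :
    cc k n k * k0 k ^ (2*i) + KK k < cc k n k * k0 k ^ (2*i') := by
  have h5 : cc k n k ≤ cc k n k * k0 k ^ (2*i) := Nat.le_mul_of_pos_right _ (kpow hk _)
  have h6 := cc_mono (n := n) hk (Nat.zero_le k)
  have h7 := numC0 hk hn (h6.trans h5)
  refine h7.trans_le ?_
  rw [mul_assoc, ← pow_add]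
  exact Nat.mul_le_mul_left _ (Nat.pow_le_pow_right (by have := k0_ge hk; omega) (by omega))

theorem numD {k n : ℕ} (hk : 2 ≤ k) (hn : 1 ≤ n) {j j' x : ℕ} (h : j < j') (hx : x ≤ n^4) :
    cc k n j + KK k < cc k n j' - (k-1) * bb k n j' - (k-1) * x := by
  obtain ⟨i, rfl⟩ : ∃ i, j' = i + 1 := ⟨j' - 1, by omega⟩
  have h3 := k0_ge hk
  have h0 := cc_mono (n := n) hk (show j ≤ i by omega)
  have hz := z_ge hk hn
  have hb := bb_ge (n := n) hk (i+1)
  have hb' := bb_ge (n := n) hk i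
  have hkk := k_le_k0 k
  have e1 : bb k n (i+1) = k0 k ^ 2 * bb k n i := by unfold bb; ring
  have e2 := cc_bb k n i
  have h4 := k0sq_le hk
  have h5 : k0 k ^ 2 * k0 k ^ 2 * bb k n i ≤ cc k n i := by
    rw [e2]; exact Nat.mul_le_mul_right _ h4
  have h6 : k * bb k n (i+1) ≤ cc k n i := by
    refine le_trans ?_ h5
    rw [e1, ← mul_assoc]
    exact Nat.mul_le_mul_right _ (Nat.mul_le_mul_right _ (by nlinarith))
  have h7 : (k-1) * bb k n (i+1) ≤ k * bb k n (i+1) := Nat.mul_le_mul_right _ (by omega)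
  have h8 : (k-1) * x ≤ k * bb k n (i+1) := Nat.mul_le_mul (by omega) (by omega)
  have h9 : bb k n (i+1) ≤ k * bb k n (i+1) := Nat.le_mul_of_pos_left _ (by omega)
  have h10 : 9 * cc k n i ≤ cc k n (i+1) := by
    rw [cc_succ]; exact Nat.mul_le_mul_right _ (by nlinarith)
  omega

def FF (k j : ℕ) : ℕ := j * k - (j+1) * j / 2

theorem FF_succ {k j : ℕ} (h : j + 1 ≤ k) : FF k (j+1) = FF k j + (k - (j+1)) := by
  unfold FF
  have h1 : (j+1+1) * (j+1) / 2 = (j+1) * j / 2 + (j + 1) := by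
    have : (j+1+1) * (j+1) = (j+1)*j + (j+1) * 2 := by ring
    rw [this, Nat.add_mul_div_right _ _ (by norm_num)]
  have h2 : (j+1) * j / 2 ≤ j * k := by
    refine (Nat.div_le_self _ _).trans ?_
    nlinarith
  rw [h1, Nat.add_mul, one_mul]; omega

theorem FF_mono {k j j' : ℕ} (h : j ≤ j') (h' : j' ≤ k) : FF k j ≤ FF k j' := by
  induction j', h using Nat.le_induction with
  | base => rfl
  | succ m hm ih => rw [FF_succ h']; have := ih (by omega); omega

def ix (k j q : ℕ) : ℕ := FF k j + (q - j)

theorem cjq_eq {k n j q : ℕ} (h : j < q) (hq : q < k) :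
    cjq k n (j+1) (q+1) = cc k n k * k0 k ^ (2 * ix k j q) := by
  unfold cjq ix FF
  have : (j + 1 - 1) * k - (j+1)*(j+1-1)/2 + (q+1) - (j+1) = j * k - (j+1)*j/2 + (q-j) := by
    simp only [Nat.add_sub_cancel]; omega
  rw [this]

theorem ix_pos {k j q : ℕ} (h : j < q) : 1 ≤ ix k j q := by unfold ix; omega

theorem ix_lt {k j q j' q' : ℕ} (h : j < q) (hq : q < k) (h' : j' < q') (hq' : q' < k)
    (hj : j < j') : ix k j q < ix k j' q' := by
  have h1 := FF_succ (k := k) (j := j) (by omega)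
  have h2 := FF_mono (k := k) (show j + 1 ≤ j' by omega) (by omega)
  unfold ix; omega

theorem ix_inj {k j q j' q' : ℕ} (h : j < q) (hq : q < k) (h' : j' < q') (hq' : q' < k)
    (hi : ix k j q = ix k j' q') : j = j' ∧ q = q' := by
  rcases lt_trichotomy j j' with hl | hl | hl
  · have := ix_lt h hq h' hq' hl; omega
  · subst hl; refine ⟨rfl, ?_⟩; unfold ix at hi; omega
  · have := ix_lt h' hq' h hq hl; omega

theorem ix_max {k j q : ℕ} (h : j < q) (hq : q < k) : ix k j q ≤ ix k (k-2) (k-1) := by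
  rcases Nat.lt_or_ge j (k-2) with hl | hl
  · exact (ix_lt h hq (by omega) (by omega) hl).le
  · have : j = k - 2 := by omega
    subst this; unfold ix; omega

theorem cjq_lt_fix {k n j q : ℕ} (hk : 2 ≤ k) (h : j < q) (hq : q < k) :
    KK k + cjq k n (j+1) (q+1) < fixSize k n := by
  have e : cjq k n (k-1) k = cjq k n (k-2+1) (k-1+1) := by congr 1 <;> omega
  unfold fixSize
  rw [e, cjq_eq h hq, cjq_eq (by omega) (by omega)]
  have := Nat.mul_le_mul_left (cc k n k) (Nat.pow_le_pow_right (show 0 < k0 k by have := k0_ge hk; omega)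
    (Nat.mul_le_mul_left 2 (ix_max h hq)))
  omega

theorem cc_lt_cjq {k n i j q : ℕ} (hk : 2 ≤ k) (hn : 1 ≤ n) (hi : i ≤ k) (h : j < q) (hq : q < k) :
    cc k n i + KK k < cjq k n (j+1) (q+1) := by
  rw [cjq_eq h hq]
  have h1 := numC (n := n) hk hn (ix_pos (k := k) h)
  have h2 := cc_mono (n := n) hk hi
  simp at h1; omega

theorem card_pairs (k : ℕ) : Fintype.card {pq : Fin k × Fin k // pq.1 < pq.2} = Nat.choose k 2 := by
  rw [Fintype.card_subtype, Finset.card_filter, ← Finset.univ_product_univ, Finset.sum_product_right]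
  simp only [← Finset.card_filter]
  have : ∀ y : Fin k, (Finset.univ.filter (fun a : Fin k => a < y)).card = y.1 := by
    intro y
    have : (Finset.univ.filter (fun a : Fin k => a < y)) = Finset.Iio y := by ext; simp
    rw [this, Fin.card_Iio]
  simp only [this]
  rw [Fin.sum_univ_eq_sum_range (fun i => i), Finset.sum_range_id, Nat.choose_two_right]

end MCCP

set_option linter.unnecessarySimpa false
set_option linter.unusedVariables false

namespace MCCP

section
variable {k n : ℕ} {x : Fin n → ℕ} {M : SimpleGraph (Fin k × Fin n)}

instance : Finite (EIdx k n M) := by unfold EIdx; infer_instance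

abbrev fixV (x : Fin n → ℕ) (M : SimpleGraph (Fin k × Fin n)) (c : Fin (KK k + 1))
    (d : Option (Fin (fixSize k n - 1))) : VV k n x M :=
  Sum.inr (Sum.inr (Sum.inr (c, d)))

def par : VV k n x M → VV k n x M
  | Sum.inl _ => rootT k n x M
  | Sum.inr (Sum.inl ⟨_, none⟩) => rootT k n x M
  | Sum.inr (Sum.inl ⟨v, some _⟩) => vgRoot k n x M v
  | Sum.inr (Sum.inr (Sum.inl ⟨_, Sum.inl none⟩)) => rootT k n x M
  | Sum.inr (Sum.inr (Sum.inl ⟨e, Sum.inl (some _)⟩)) => seRoot k n x e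
  | Sum.inr (Sum.inr (Sum.inl ⟨e, Sum.inr (Sum.inl none)⟩)) => seRoot k n x e
  | Sum.inr (Sum.inr (Sum.inl ⟨e, Sum.inr (Sum.inl (some _))⟩)) => sp1Root k n x e
  | Sum.inr (Sum.inr (Sum.inl ⟨e, Sum.inr (Sum.inr none)⟩)) => seRoot k n x e
  | Sum.inr (Sum.inr (Sum.inl ⟨e, Sum.inr (Sum.inr (some _))⟩)) => sp2Root k n x e
  | Sum.inr (Sum.inr (Sum.inr (_, none))) => rootT k n x M
  | Sum.inr (Sum.inr (Sum.inr (c, some _))) => fixV x M c none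

def dep : VV k n x M → ℕ
  | Sum.inl _ => 0
  | Sum.inr (Sum.inl ⟨_, none⟩) => 1
  | Sum.inr (Sum.inl ⟨_, some _⟩) => 2
  | Sum.inr (Sum.inr (Sum.inl ⟨_, Sum.inl none⟩)) => 1
  | Sum.inr (Sum.inr (Sum.inl ⟨_, Sum.inl (some _)⟩)) => 2
  | Sum.inr (Sum.inr (Sum.inl ⟨_, Sum.inr (Sum.inl none)⟩)) => 2
  | Sum.inr (Sum.inr (Sum.inl ⟨_, Sum.inr (Sum.inl (some _))⟩)) => 3
  | Sum.inr (Sum.inr (Sum.inl ⟨_, Sum.inr (Sum.inr none)⟩)) => 2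
  | Sum.inr (Sum.inr (Sum.inl ⟨_, Sum.inr (Sum.inr (some _))⟩)) => 3
  | Sum.inr (Sum.inr (Sum.inr (_, none))) => 1
  | Sum.inr (Sum.inr (Sum.inr (_, some _))) => 2

theorem dep_par (v : VV k n x M) (hv : v ≠ rootT k n x M) : dep (par v) + 1 = dep v := by
  rcases v with _ | ⟨v, _ | d⟩ | ⟨e, (_ | d) | (_ | d) | (_ | d)⟩ | ⟨c, _ | d⟩ <;>
    first
    | exact absurd rfl hv
    | rfl

theorem par3 (v : VV k n x M) : par (par (par v)) = rootT k n x M := by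
  rcases v with _ | ⟨v, _ | d⟩ | ⟨e, (_ | d) | (_ | d) | (_ | d)⟩ | ⟨c, _ | d⟩ <;> rfl

theorem adj_par (v : VV k n x M) (hv : v ≠ rootT k n x M) : (TG k n x M).Adj v (par v) := by
  unfold TG
  rw [SimpleGraph.fromRel_adj]
  refine ⟨fun h => ?_, Or.inr ?_⟩
  · have := dep_par v hv; rw [← h] at this; omega
  · rcases v with _ | ⟨v, _ | d⟩ | ⟨e, (_ | d) | (_ | d) | (_ | d)⟩ | ⟨c, _ | d⟩ <;>
    first
    | exact absurd rfl hv
    | simp [relMCC, par, rootT, vgRoot, seRoot, sp1Root, sp2Root, code, codeRel]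

def DD (EP : Set (Sym2 (VV k n x M))) : Set (VV k n x M) :=
  {v | v ≠ rootT k n x M ∧ s(v, par v) ∈ EP}

theorem DD_card (EP : Set (Sym2 (VV k n x M))) : (DD EP).ncard ≤ EP.ncard := by
  refine Set.ncard_le_ncard_of_injOn (fun v => s(v, par v)) (fun v hv => hv.2) ?_ (Set.toFinite _)
  intro v hv w hw h
  simp only [Sym2.eq_iff] at h
  rcases h with h | ⟨h1, h2⟩
  · exact h.1
  · have a := dep_par v hv.1
    have b := dep_par w hw.1
    rw [← h1] at b; rw [h2] at a; omega

def sub (d : VV k n x M) : Set (VV k n x M) := {v | v = d ∨ par v = d ∨ par (par v) = d}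

theorem ncard_range_le {α β : Type} [Finite α] (f : α → β) : (Set.range f).ncard ≤ Nat.card α := by
  rw [← Set.image_univ, ← Set.ncard_univ]; exact Set.ncard_image_le

theorem card_opt (m : ℕ) : Nat.card (Option (Fin m)) = m + 1 := by simp

theorem sub_leafvg (v) (d) :
    (sub (Sum.inr (Sum.inl ⟨v, some d⟩) : VV k n x M)).ncard ≤ 1 := by
  have : sub (Sum.inr (Sum.inl ⟨v, some d⟩) : VV k n x M) ⊆ {Sum.inr (Sum.inl ⟨v, some d⟩)} := by
    intro w hw
    rcases w with _ | ⟨v, _ | d⟩ | ⟨e, (_ | d) | (_ | d) | (_ | d)⟩ | ⟨c, _ | d⟩ <;>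
      rcases hw with hw | hw | hw <;> cases hw <;> rfl
  simpa using Set.ncard_le_ncard this

theorem sub_leafse (e) (d) :
    (sub (Sum.inr (Sum.inr (Sum.inl ⟨e, Sum.inl (some d)⟩)) : VV k n x M)).ncard ≤ 1 := by
  have : sub (Sum.inr (Sum.inr (Sum.inl ⟨e, Sum.inl (some d)⟩)) : VV k n x M) ⊆
      {Sum.inr (Sum.inr (Sum.inl ⟨e, Sum.inl (some d)⟩))} := by
    intro w hw
    rcases w with _ | ⟨v, _ | d⟩ | ⟨e, (_ | d) | (_ | d) | (_ | d)⟩ | ⟨c, _ | d⟩ <;>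
      rcases hw with hw | hw | hw <;> cases hw <;> rfl
  simpa using Set.ncard_le_ncard this

theorem sub_leafsp1 (e) (d) :
    (sub (Sum.inr (Sum.inr (Sum.inl ⟨e, Sum.inr (Sum.inl (some d))⟩)) : VV k n x M)).ncard ≤ 1 := by
  have : sub (Sum.inr (Sum.inr (Sum.inl ⟨e, Sum.inr (Sum.inl (some d))⟩)) : VV k n x M) ⊆
      {Sum.inr (Sum.inr (Sum.inl ⟨e, Sum.inr (Sum.inl (some d))⟩))} := by
    intro w hw
    rcases w with _ | ⟨v, _ | d⟩ | ⟨e, (_ | d) | (_ | d) | (_ | d)⟩ | ⟨c, _ | d⟩ <;>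
      rcases hw with hw | hw | hw <;> cases hw <;> rfl
  simpa using Set.ncard_le_ncard this

theorem sub_leafsp2 (e) (d) :
    (sub (Sum.inr (Sum.inr (Sum.inl ⟨e, Sum.inr (Sum.inr (some d))⟩)) : VV k n x M)).ncard ≤ 1 := by
  have : sub (Sum.inr (Sum.inr (Sum.inl ⟨e, Sum.inr (Sum.inr (some d))⟩)) : VV k n x M) ⊆
      {Sum.inr (Sum.inr (Sum.inl ⟨e, Sum.inr (Sum.inr (some d))⟩))} := by
    intro w hw
    rcases w with _ | ⟨v, _ | d⟩ | ⟨e, (_ | d) | (_ | d) | (_ | d)⟩ | ⟨c, _ | d⟩ <;>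
      rcases hw with hw | hw | hw <;> cases hw <;> rfl
  simpa using Set.ncard_le_ncard this

theorem sub_leaffix (c) (d) : (sub (fixV x M c (some d))).ncard ≤ 1 := by
  have : sub (fixV x M c (some d)) ⊆ {fixV x M c (some d)} := by
    intro w hw
    rcases w with _ | ⟨v, _ | d⟩ | ⟨e, (_ | d) | (_ | d) | (_ | d)⟩ | ⟨c, _ | d⟩ <;>
      rcases hw with hw | hw | hw <;> cases hw <;> rfl
  simpa using Set.ncard_le_ncard this

theorem sub_vg (v) : (sub (vgRoot k n x M v)).ncard ≤ vgSize k n x v - 1 + 1 := by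
  have : sub (vgRoot k n x M v) ⊆ Set.range
      (fun d => (Sum.inr (Sum.inl ⟨v, d⟩) : VV k n x M)) := by
    intro w hw
    rcases w with _ | ⟨v, _ | d⟩ | ⟨e, (_ | d) | (_ | d) | (_ | d)⟩ | ⟨c, _ | d⟩ <;>
      rcases hw with hw | hw | hw <;> cases hw <;> exact ⟨_, rfl⟩
  refine (Set.ncard_le_ncard this).trans ((ncard_range_le _).trans ?_)
  rw [card_opt]

theorem sub_sp1 (e : EIdx k n M) : (sub (sp1Root k n x e)).ncard ≤ spSize k n x e.1.1 - 1 + 1 := by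
  have : sub (sp1Root k n x e) ⊆ Set.range
      (fun d => (Sum.inr (Sum.inr (Sum.inl ⟨e, Sum.inr (Sum.inl d)⟩)) : VV k n x M)) := by
    intro w hw
    rcases w with _ | ⟨v, _ | d⟩ | ⟨e, (_ | d) | (_ | d) | (_ | d)⟩ | ⟨c, _ | d⟩ <;>
      rcases hw with hw | hw | hw <;> cases hw <;> exact ⟨_, rfl⟩
  refine (Set.ncard_le_ncard this).trans ((ncard_range_le _).trans ?_)
  rw [card_opt]

theorem sub_sp2 (e : EIdx k n M) : (sub (sp2Root k n x e)).ncard ≤ spSize k n x e.1.2 - 1 + 1 := by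
  have : sub (sp2Root k n x e) ⊆ Set.range
      (fun d => (Sum.inr (Sum.inr (Sum.inl ⟨e, Sum.inr (Sum.inr d)⟩)) : VV k n x M)) := by
    intro w hw
    rcases w with _ | ⟨v, _ | d⟩ | ⟨e, (_ | d) | (_ | d) | (_ | d)⟩ | ⟨c, _ | d⟩ <;>
      rcases hw with hw | hw | hw <;> cases hw <;> exact ⟨_, rfl⟩
  refine (Set.ncard_le_ncard this).trans ((ncard_range_le _).trans ?_)
  rw [card_opt]

theorem sub_se (e : EIdx k n M) : (sub (seRoot k n x e)).ncard ≤
    (seSize k n e - 1 + 1) + ((spSize k n x e.1.1 - 1 + 1) + (spSize k n x e.1.2 - 1 + 1)) := by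
  have : sub (seRoot k n x e) ⊆ Set.range
      (fun d => (Sum.inr (Sum.inr (Sum.inl ⟨e, d⟩)) : VV k n x M)) := by
    intro w hw
    rcases w with _ | ⟨v, _ | d⟩ | ⟨e, (_ | d) | (_ | d) | (_ | d)⟩ | ⟨c, _ | d⟩ <;>
      rcases hw with hw | hw | hw <;> cases hw <;> exact ⟨_, rfl⟩
  refine (Set.ncard_le_ncard this).trans ((ncard_range_le _).trans ?_)
  rw [Nat.card_sum, Nat.card_sum, card_opt, card_opt, card_opt]

section sol
variable {EP : Set (Sym2 (VV k n x M))} {lam : VV k n x M → Grp k}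
  (hP : IsSolutionLe (TG k n x M) EP (KK k) (sizesMCC k n x M) lam)
include hP

theorem DD_le : (DD EP).ncard ≤ KK k := (DD_card EP).trans hP.2.1

theorem lam_par (v : VV k n x M) (hv : v ∉ DD EP) : lam v = lam (par v) := by
  by_cases h : v = rootT k n x M
  · subst h; rfl
  · refine hP.2.2.1 _ _ (SimpleGraph.Adj.reachable ?_)
    rw [SimpleGraph.deleteEdges_adj]
    exact ⟨adj_par v h, fun h' => hv ⟨h, h'⟩⟩

theorem exists_top {g : Grp k} (hr : lam (rootT k n x M) ≠ g) (v : VV k n x M) (hv : lam v = g) :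
    ∃ d ∈ DD EP, lam d = g ∧ v ∈ sub d := by
  by_cases h1 : v ∈ DD EP
  · exact ⟨v, h1, hv, Or.inl rfl⟩
  have e1 := lam_par hP v h1
  by_cases h2 : par v ∈ DD EP
  · exact ⟨_, h2, e1 ▸ hv, Or.inr (Or.inl rfl)⟩
  have e2 := lam_par hP _ h2
  by_cases h3 : par (par v) ∈ DD EP
  · exact ⟨_, h3, e2 ▸ e1 ▸ hv, Or.inr (Or.inr rfl)⟩
  have e3 := lam_par hP _ h3
  rw [par3] at e3
  exact absurd (e3 ▸ e2 ▸ e1 ▸ hv) hr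

theorem upper {g : Grp k} (hr : lam (rootT k n x M) ≠ g) (U : ℕ)
    (hU : ∀ d ∈ DD EP, lam d = g → (sub d).ncard ≤ U) : sizesMCC k n x M g ≤ KK k * U := by
  classical
  have hfin : (DD EP).Finite := Set.toFinite _
  let F : Finset (VV k n x M) := hfin.toFinset.filter (fun d => lam d = g)
  have hsub : {v | lam v = g} ⊆
      ((F.biUnion (fun d => (Set.toFinite (sub d)).toFinset) : Finset _) : Set (VV k n x M)) := by
    intro v hv
    obtain ⟨d, hd, hg, hs⟩ := exists_top hP hr v hv
    simp only [Finset.coe_biUnion, Set.mem_iUnion]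
    exact ⟨d, by simp [F, hd, hg], by simpa using hs⟩
  rw [← hP.2.2.2 g]
  refine (Set.ncard_le_ncard hsub).trans ?_
  rw [Set.ncard_coe_finset]
  refine (Finset.card_biUnion_le_card_mul _ _ U ?_).trans (Nat.mul_le_mul_right _ ?_)
  · intro d hd
    simp only [F, Finset.mem_filter, Set.Finite.mem_toFinset] at hd
    rw [← Set.ncard_eq_toFinset_card]
    exact hU d hd.1 hd.2
  · refine (Finset.card_filter_le _ _).trans ?_
    rw [← Set.ncard_eq_toFinset_card]
    exact DD_le hP

theorem lower {α : Type} (f : α → VV k n x M) (hf : Function.Injective f) (g : Grp k)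
    (h : ∀ a, f a ∈ DD EP ∨ lam (f a) = g) : Nat.card α ≤ KK k + sizesMCC k n x M g := by
  rw [← Set.ncard_range_of_injective hf, ← hP.2.2.2 g]
  have : Set.range f ⊆ DD EP ∪ {v | lam v = g} := by
    rintro _ ⟨a, rfl⟩; exact h a
  refine (Set.ncard_le_ncard this).trans ((Set.ncard_union_le _ _).trans ?_)
  exact Nat.add_le_add_right (DD_le hP) _

theorem low_fix (c) : fixSize k n ≤ KK k + sizesMCC k n x M (lam (fixV x M c none)) := by
  have := lower hP (fun d => fixV x M c d) (fun a b h => by simpa using h)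
    (lam (fixV x M c none)) (fun d => by
      rcases d with _ | d
      · exact Or.inr rfl
      · by_cases h : fixV x M c (some d) ∈ DD EP
        · exact Or.inl h
        · exact Or.inr (lam_par hP _ h))
  rw [card_opt] at this; omega

theorem low_vg (v) : vgSize k n x v ≤ KK k + sizesMCC k n x M (lam (vgRoot k n x M v)) := by
  have := lower hP (fun d => (Sum.inr (Sum.inl ⟨v, d⟩) : VV k n x M)) (fun a b h => by simpa using h)
    (lam (vgRoot k n x M v)) (fun d => by
      rcases d with _ | d
      · exact Or.inr rfl
      · by_cases h : (Sum.inr (Sum.inl ⟨v, some d⟩) : VV k n x M) ∈ DD EP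
        · exact Or.inl h
        · exact Or.inr (lam_par hP _ h))
  rw [card_opt] at this; omega

theorem low_se (e : EIdx k n M) :
    seSize k n e ≤ KK k + sizesMCC k n x M (lam (seRoot k n x e)) := by
  have := lower hP (fun d => (Sum.inr (Sum.inr (Sum.inl ⟨e, Sum.inl d⟩)) : VV k n x M))
    (fun a b h => by simpa using h)
    (lam (seRoot k n x e)) (fun d => by
      rcases d with _ | d
      · exact Or.inr rfl
      · by_cases h : (Sum.inr (Sum.inr (Sum.inl ⟨e, Sum.inl (some d)⟩)) : VV k n x M) ∈ DD EP
        · exact Or.inl h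
        · exact Or.inr (lam_par hP _ h))
  rw [card_opt] at this; omega

theorem low_sp1 (e : EIdx k n M) (h1 : sp1Root k n x e ∉ DD EP) :
    seSize k n e + spSize k n x e.1.1 ≤ KK k + sizesMCC k n x M (lam (seRoot k n x e)) := by
  have := lower hP (α := Option (Fin (seSize k n e - 1)) ⊕ Option (Fin (spSize k n x e.1.1 - 1)))
    (fun d => (Sum.inr (Sum.inr (Sum.inl ⟨e, d.elim Sum.inl (fun d => Sum.inr (Sum.inl d))⟩)) :
      VV k n x M))
    (fun a b h => by rcases a with a | a <;> rcases b with b | b <;> simpa using h)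
    (lam (seRoot k n x e)) (fun d => by
      by_cases h : (Sum.inr (Sum.inr (Sum.inl ⟨e, d.elim Sum.inl (fun d => Sum.inr (Sum.inl d))⟩)) :
          VV k n x M) ∈ DD EP
      · exact Or.inl h
      · rcases d with (_ | d) | (_ | d)
        · exact Or.inr rfl
        · exact Or.inr (lam_par hP _ h)
        · exact Or.inr (lam_par hP _ h)
        · exact Or.inr ((lam_par hP _ h).trans (lam_par hP _ h1)))
  rw [Nat.card_sum, card_opt, card_opt] at this; omega

theorem low_sp2 (e : EIdx k n M) (h1 : sp2Root k n x e ∉ DD EP) :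
    seSize k n e + spSize k n x e.1.2 ≤ KK k + sizesMCC k n x M (lam (seRoot k n x e)) := by
  have := lower hP (α := Option (Fin (seSize k n e - 1)) ⊕ Option (Fin (spSize k n x e.1.2 - 1)))
    (fun d => (Sum.inr (Sum.inr (Sum.inl ⟨e, d.elim Sum.inl (fun d => Sum.inr (Sum.inr d))⟩)) :
      VV k n x M))
    (fun a b h => by rcases a with a | a <;> rcases b with b | b <;> simpa using h)
    (lam (seRoot k n x e)) (fun d => by
      by_cases h : (Sum.inr (Sum.inr (Sum.inl ⟨e, d.elim Sum.inl (fun d => Sum.inr (Sum.inr d))⟩)) :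
          VV k n x M) ∈ DD EP
      · exact Or.inl h
      · rcases d with (_ | d) | (_ | d)
        · exact Or.inr rfl
        · exact Or.inr (lam_par hP _ h)
        · exact Or.inr (lam_par hP _ h)
        · exact Or.inr ((lam_par hP _ h).trans (lam_par hP _ h1)))
  rw [Nat.card_sum, card_opt, card_opt] at this; omega

theorem low_root : fixSize k n ≤ KK k + sizesMCC k n x M (lam (rootT k n x M)) := by
  obtain ⟨c, hc⟩ : ∃ c, fixV x M c none ∉ DD EP := by
    by_contra! h
    have : (Set.range (fun c => fixV x M c none)).ncard ≤ (DD EP).ncard :=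
      Set.ncard_le_ncard (by rintro _ ⟨c, rfl⟩; exact h c)
    rw [Set.ncard_range_of_injective (fun a b h => by simpa using h)] at this
    have h2 := DD_le hP
    simp at this; omega
  have h1 := low_fix hP c
  rwa [lam_par hP _ hc] at h1

end sol
end
end MCCP

namespace MCCP

section
variable {k n : ℕ} {x : Fin n → ℕ} {M : SimpleGraph (Fin k × Fin n)}
variable {EP : Set (Sym2 (VV k n x M))} {lam : VV k n x M → Grp k}

theorem sp_le (hk : 2 ≤ k) (hn : 1 ≤ n) (hxbd : ∀ i, x i ≤ n^4) (v : Fin k × Fin n) :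
    spSize k n x v - 1 + 1 ≤ bb k n k + n^4 ∧ KK k < spSize k n x v := by
  have h1 := bb_mono (n := n) hk (show v.1.1 + 1 ≤ k by have := v.1.2; omega)
  have h2 := hxbd v.2
  have h3 := bb_ge (n := n) hk (v.1.1 + 1)
  have h4 := z_ge hk hn
  unfold spSize; omega

theorem vg_le (hk : 2 ≤ k) (hn : 1 ≤ n) (v : Fin k × Fin n) :
    vgSize k n x v - 1 + 1 ≤ cc k n (v.1.1 + 1) := by
  have h1 := cc_mono (n := n) hk (Nat.zero_le (v.1.1 + 1))
  rw [cc_zero] at h1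
  have h3 := bb_ge (n := n) hk k
  have h4 := z_ge hk hn
  unfold vgSize; omega

theorem root_ne_pair (hk : 2 ≤ k)
    (hP : IsSolutionLe (TG k n x M) EP (KK k) (sizesMCC k n x M) lam)
    (pq : {pq : Fin k × Fin k // pq.1 < pq.2}) : lam (rootT k n x M) ≠ gPair pq := by
  intro h
  have h1 := low_root hP
  rw [h] at h1
  have h2 := cjq_lt_fix (n := n) hk pq.2 pq.1.2.2
  simp only [gPair, sizesMCC] at h1; omega

theorem root_ne_col (hk : 2 ≤ k) (hn : 1 ≤ n)
    (hP : IsSolutionLe (TG k n x M) EP (KK k) (sizesMCC k n x M) lam)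
    (j : Fin k) : lam (rootT k n x M) ≠ gCol j := by
  intro h
  have h1 := low_root hP
  rw [h] at h1
  have h2 := cjq_lt_fix (n := n) (j := 0) (q := 1) hk (by omega) (by omega)
  have h3 := cc_lt_cjq (i := j.1 + 1) (j := 0) (q := 1) hk hn j.2 (by omega) (by omega)
  simp only [gCol, sizesMCC] at h1; omega

theorem exP (hk : 2 ≤ k) (hn : 1 ≤ n) (hxbd : ∀ i, x i ≤ n^4)
    (hP : IsSolutionLe (TG k n x M) EP (KK k) (sizesMCC k n x M) lam)
    (pq : {pq : Fin k × Fin k // pq.1 < pq.2}) :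
    ∃ e : EIdx k n M, e.1.1.1 = pq.1.1 ∧ e.1.2.1 = pq.1.2 ∧ seRoot k n x e ∈ DD EP ∧
      lam (seRoot k n x e) = gPair pq := by
  by_contra! hcon
  have hlt : pq.1.1.1 < pq.1.2.1 := pq.2
  have hix := ix_pos (k := k) hlt
  obtain ⟨i, hi⟩ : ∃ i, ix k pq.1.1 pq.1.2 = i + 1 := ⟨_, (Nat.sub_add_cancel hix).symm⟩
  have hA := numA (n := n) hk hn i
  have hz := z_ge hk hn
  have hbz := bb_ge (n := n) hk k
  have hs : sizesMCC k n x M (gPair pq) = cc k n k * k0 k ^ (2*(i+1)) := by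
    rw [← hi, ← cjq_eq hlt pq.1.2.2]; rfl
  have hup := upper hP (root_ne_pair hk hP pq) (cc k n k * k0 k ^ (2*i) + 4 * bb k n k) ?_
  · omega
  intro d hd hg
  rcases d with u | ⟨v, _ | d⟩ | ⟨e, (_ | d) | (_ | d) | (_ | d)⟩ | ⟨c, _ | d⟩
  · exact absurd rfl hd.1
  · refine (sub_vg v).trans ((vg_le hk hn v).trans ?_)
    have h1 := cc_mono (n := n) hk (show v.1.1 + 1 ≤ k by have := v.1.2; omega)
    have h5 : cc k n k ≤ cc k n k * k0 k ^ (2*i) := Nat.le_mul_of_pos_right _ (kpow hk _)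
    omega
  · exact (sub_leafvg v d).trans (by omega)
  · have hlow := low_se hP e
    change lam (seRoot k n x e) = _ at hg
    rw [hg, hs] at hlow
    refine (sub_se e).trans ?_
    have s1 := (sp_le hk hn hxbd e.1.1).1
    have s2 := (sp_le hk hn hxbd e.1.2).1
    have helt : e.1.1.1.1 < e.1.2.1.1 := e.2.2
    have hse : seSize k n e = cc k n k * k0 k ^ (2 * ix k e.1.1.1 e.1.2.1) :=
      cjq_eq helt e.1.2.1.2
    have : ix k e.1.1.1 e.1.2.1 ≤ i := by
      by_contra! hgt
      rcases Nat.eq_or_lt_of_le hgt with h | h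
      · have := ix_inj helt e.1.2.1.2 hlt pq.1.2.2 (by omega)
        exact hcon e (Fin.ext this.1) (Fin.ext this.2) hd hg
      · have := numC (n := n) hk hn h
        simp only [Nat.succ_eq_add_one] at this
        omega
    have h6 : seSize k n e ≤ cc k n k * k0 k ^ (2*i) := by
      rw [hse]
      exact Nat.mul_le_mul_left _ (Nat.pow_le_pow_right (by have := k0_ge hk; omega) (by omega))
    have h5 : cc k n k ≤ cc k n k * k0 k ^ (2*i) := Nat.le_mul_of_pos_right _ (kpow hk _)
    have h7 := cc_mono (n := n) hk (Nat.zero_le k)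
    rw [cc_zero] at h7
    omega
  · exact (sub_leafse e d).trans (by omega)
  · have := (sp_le hk hn hxbd e.1.1).1
    exact (sub_sp1 e).trans (by omega)
  · exact (sub_leafsp1 e d).trans (by omega)
  · have := (sp_le hk hn hxbd e.1.2).1
    exact (sub_sp2 e).trans (by omega)
  · exact (sub_leafsp2 e d).trans (by omega)
  · exfalso
    have hlow := low_fix hP c
    change lam (fixV x M c none) = _ at hg
    rw [hg] at hlow
    have h2 := cjq_lt_fix (n := n) hk pq.2 pq.1.2.2
    simp only [gPair, sizesMCC] at hlow; omega
  · exact (sub_leaffix c d).trans (by omega)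

theorem exV (hk : 2 ≤ k) (hn : 1 ≤ n) (hxbd : ∀ i, x i ≤ n^4)
    (hP : IsSolutionLe (TG k n x M) EP (KK k) (sizesMCC k n x M) lam) (j : Fin k) :
    ∃ v : Fin k × Fin n, v.1 = j ∧ vgRoot k n x M v ∈ DD EP := by
  by_contra! hcon
  have hB := numB (n := n) hk hn j.1
  have hz := z_ge hk hn
  have hbz := bb_ge (n := n) hk k
  have hc0 := cc_mono (n := n) hk (Nat.zero_le j.1)
  rw [cc_zero] at hc0
  have hs : sizesMCC k n x M (gCol j) = cc k n (j.1+1) := rfl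
  have hup := upper hP (root_ne_col hk hn hP j) (cc k n j.1 + n^4) ?_
  · omega
  intro d hd hg
  rcases d with u | ⟨v, _ | d⟩ | ⟨e, (_ | d) | (_ | d) | (_ | d)⟩ | ⟨c, _ | d⟩
  · exact absurd rfl hd.1
  · refine (sub_vg v).trans ((vg_le hk hn v).trans ?_)
    change lam (vgRoot k n x M v) = _ at hg
    have hlow := low_vg hP v
    rw [hg, hs] at hlow
    rcases lt_trichotomy v.1.1 j.1 with h | h | h
    · have := cc_mono (n := n) hk (show v.1.1 + 1 ≤ j.1 from h)
      omega
    · exact absurd hd (hcon v (Fin.ext h))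
    · have := numD hk hn (show j.1 + 1 < v.1.1 + 1 by omega) (hxbd v.2)
      unfold vgSize at hlow; omega
  · exact (sub_leafvg v d).trans (by omega)
  · exfalso
    have hlow := low_se hP e
    change lam (seRoot k n x e) = _ at hg
    rw [hg, hs] at hlow
    have := cc_lt_cjq (n := n) hk hn (show j.1 + 1 ≤ k from j.2) (show e.1.1.1.1 < e.1.2.1.1 from e.2.2)
      e.1.2.1.2
    unfold seSize at hlow; omega
  · exact (sub_leafse e d).trans (by omega)
  · have := (sp_le hk hn hxbd e.1.1).1
    exact (sub_sp1 e).trans (by omega)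
  · exact (sub_leafsp1 e d).trans (by omega)
  · have := (sp_le hk hn hxbd e.1.2).1
    exact (sub_sp2 e).trans (by omega)
  · exact (sub_leafsp2 e d).trans (by omega)
  · exfalso
    have hlow := low_fix hP c
    change lam (fixV x M c none) = _ at hg
    rw [hg] at hlow
    have h2 := cjq_lt_fix (n := n) (j := 0) (q := 1) hk (by omega) (by omega)
    have h3 := cc_lt_cjq (i := j.1 + 1) (j := 0) (q := 1) hk hn j.2 (by omega) (by omega)
    omega
  · exact (sub_leaffix c d).trans (by omega)

theorem sp_cut (hk : 2 ≤ k) (hn : 1 ≤ n) (hxbd : ∀ i, x i ≤ n^4)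
    (hP : IsSolutionLe (TG k n x M) EP (KK k) (sizesMCC k n x M) lam)
    (pq : {pq : Fin k × Fin k // pq.1 < pq.2}) (e : EIdx k n M)
    (h1 : e.1.1.1 = pq.1.1) (h2 : e.1.2.1 = pq.1.2) (hg : lam (seRoot k n x e) = gPair pq) :
    sp1Root k n x e ∈ DD EP ∧ sp2Root k n x e ∈ DD EP := by
  have hs : seSize k n e = sizesMCC k n x M (gPair pq) := by
    unfold seSize; rw [h1, h2]; rfl
  have s1 := (sp_le hk hn hxbd e.1.1).2
  have s2 := (sp_le hk hn hxbd e.1.2).2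
  constructor
  · by_contra h
    have := low_sp1 hP e h
    rw [hg] at this; omega
  · by_contra h
    have := low_sp2 hP e h
    rw [hg] at this; omega

theorem uniq (hk : 2 ≤ k) (hn : 1 ≤ n) (hxbd : ∀ i, x i ≤ n^4)
    (hP : IsSolutionLe (TG k n x M) EP (KK k) (sizesMCC k n x M) lam)
    (E : {pq : Fin k × Fin k // pq.1 < pq.2} → EIdx k n M)
    (hE : ∀ pq, (E pq).1.1.1 = pq.1.1 ∧ (E pq).1.2.1 = pq.1.2 ∧ seRoot k n x (E pq) ∈ DD EP ∧
      lam (seRoot k n x (E pq)) = gPair pq)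
    (e : EIdx k n M) (he : seRoot k n x e ∈ DD EP) : ∃ pq, E pq = e := by
  choose W hW using exV hk hn hxbd hP
  have hEinj : Function.Injective E := by
    intro a b h
    apply Subtype.ext
    apply Prod.ext
    · rw [← (hE a).1, ← (hE b).1, h]
    · rw [← (hE a).2.1, ← (hE b).2.1, h]
  have hWinj : Function.Injective W := by
    intro a b h
    rw [← (hW a).1, ← (hW b).1, h]
  let PT := {pq : Fin k × Fin k // pq.1 < pq.2}
  let f : (Fin k ⊕ PT ⊕ PT ⊕ PT) → VV k n x M := fun a => match a with
    | Sum.inl j => vgRoot k n x M (W j)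
    | Sum.inr (Sum.inl p) => seRoot k n x (E p)
    | Sum.inr (Sum.inr (Sum.inl p)) => sp1Root k n x (E p)
    | Sum.inr (Sum.inr (Sum.inr p)) => sp2Root k n x (E p)
  have hf : Function.Injective f := by
    rintro (a | a | a | a) (b | b | b | b) h
    · have : W a = W b := by
        change vgRoot k n x M (W a) = vgRoot k n x M (W b) at h
        generalize W a = u at h
        generalize W b = w at h
        cases h; rfl
      rw [hWinj this]
    · cases h
    · cases h
    · cases h
    · cases h
    · have : E a = E b := by
        change seRoot k n x (E a) = seRoot k n x (E b) at h
        generalize E a = u at h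
        generalize E b = w at h
        cases h; rfl
      rw [hEinj this]
    · exfalso
      change seRoot k n x (E a) = sp1Root k n x (E b) at h
      generalize E a = u at h
      generalize E b = w at h
      cases h
    · exfalso
      change seRoot k n x (E a) = sp2Root k n x (E b) at h
      generalize E a = u at h
      generalize E b = w at h
      cases h
    · cases h
    · exfalso
      change sp1Root k n x (E a) = seRoot k n x (E b) at h
      generalize E a = u at h
      generalize E b = w at h
      cases h
    · have : E a = E b := by
        change sp1Root k n x (E a) = sp1Root k n x (E b) at h
        generalize E a = u at h
        generalize E b = w at h
        cases h; rfl
      rw [hEinj this]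
    · exfalso
      change sp1Root k n x (E a) = sp2Root k n x (E b) at h
      generalize E a = u at h
      generalize E b = w at h
      cases h
    · cases h
    · exfalso
      change sp2Root k n x (E a) = seRoot k n x (E b) at h
      generalize E a = u at h
      generalize E b = w at h
      cases h
    · exfalso
      change sp2Root k n x (E a) = sp1Root k n x (E b) at h
      generalize E a = u at h
      generalize E b = w at h
      cases h
    · have : E a = E b := by
        change sp2Root k n x (E a) = sp2Root k n x (E b) at h
        generalize E a = u at h
        generalize E b = w at h
        cases h; rfl
      rw [hEinj this]
  have hsub : Set.range f ⊆ DD EP := by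
    rintro _ ⟨a | a | a | a, rfl⟩
    · exact (hW a).2
    · exact (hE a).2.2.1
    · exact (sp_cut hk hn hxbd hP a (E a) (hE a).1 (hE a).2.1 (hE a).2.2.2).1
    · exact (sp_cut hk hn hxbd hP a (E a) (hE a).1 (hE a).2.1 (hE a).2.2.2).2
  have hcard : (Set.range f).ncard = KK k := by
    rw [Set.ncard_range_of_injective hf, Nat.card_eq_fintype_card]
    simp only [Fintype.card_sum, PT, card_pairs, Fintype.card_fin, KK]
    omega
  have heq : Set.range f = DD EP := by
    apply Set.eq_of_subset_of_ncard_le hsub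
    rw [hcard]; exact DD_le hP
  rw [← heq] at he
  obtain ⟨a | a | a | a, h⟩ := he
  · cases h
  · refine ⟨a, ?_⟩
    change seRoot k n x (E a) = seRoot k n x e at h
    generalize E a = u at h
    cases h; rfl
  · exfalso
    change sp1Root k n x (E a) = seRoot k n x e at h
    generalize E a = u at h
    cases h
  · exfalso
    change sp2Root k n x (E a) = seRoot k n x e at h
    generalize E a = u at h
    cases h

theorem mem_DD (e : EIdx k n M) :
    s(rootT k n x M, seRoot k n x e) ∈ EP ↔ seRoot k n x e ∈ DD EP := by
  have : s(seRoot k n x e, par (seRoot k n x e)) = s(rootT k n x M, seRoot k n x e) := Sym2.eq_swap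
  constructor
  · intro h
    exact ⟨fun h => (by cases h), (by rw [this]; exact h)⟩
  · intro h
    rw [← this]; exact h.2

theorem reach_sub (e : EIdx k n M) (h0 : seRoot k n x e ∈ DD EP) (h1 : sp1Root k n x e ∈ DD EP)
    (h2 : sp2Root k n x e ∈ DD EP) :
    {w | ((TG k n x M).deleteEdges EP).Reachable (seRoot k n x e) w} ⊆ SeSet k n x e := by
  have step : ∀ v w : VV k n x M, v ∈ SeSet k n x e → ((TG k n x M).deleteEdges EP).Adj v w →
      w ∈ SeSet k n x e := by
    rintro v w ⟨d, rfl⟩ hadj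
    rw [SimpleGraph.deleteEdges_adj] at hadj
    obtain ⟨ha, hn⟩ := hadj
    unfold TG at ha
    rw [SimpleGraph.fromRel_adj] at ha
    obtain ⟨-, ha⟩ := ha
    rcases w with u | ⟨v, d'⟩ | ⟨e', d'⟩ | ⟨c, d'⟩
    · rcases ha with ha | ha
      · exact ha.elim
      · rcases d with _ | d
        · exact absurd h0.2 hn
        · simp [relMCC, code] at ha
    · rcases ha with ha | ha <;> exact ha.elim
    · have he : e = e' := by
        rcases ha with ha | ha
        · exact ha.1
        · exact ha.1.symm
      subst he
      rcases d' with d' | (_ | d') | (_ | d')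
      · exact ⟨_, rfl⟩
      · rcases d with _ | d
        · exfalso; apply hn; rw [Sym2.eq_swap]; exact h1.2
        · rcases ha with ha | ha <;> exact ha.2.elim
      · rcases d with _ | d <;> rcases ha with ha | ha <;> exact ha.2.elim
      · rcases d with _ | d
        · exfalso; apply hn; rw [Sym2.eq_swap]; exact h2.2
        · rcases ha with ha | ha <;> exact ha.2.elim
      · rcases d with _ | d <;> rcases ha with ha | ha <;> exact ha.2.elim
    · rcases ha with ha | ha <;> exact ha.elim
  rintro w ⟨p⟩
  have gen : ∀ u v : VV k n x M, ∀ p : ((TG k n x M).deleteEdges EP).Walk u v,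
      u ∈ SeSet k n x e → v ∈ SeSet k n x e := by
    intro u v p
    induction p with
    | nil => exact id
    | cons h p ih => exact fun hu => ih (step _ _ hu h)
  exact gen _ _ p ⟨none, rfl⟩

end
end MCCP

/-- For every solution `P` of `I'` and all colors `j < q`, `P` cuts exactly one edge
`r r_e` between the root `r` of `T` and the root `r_e` of an edge-gadget `T_e`
corresponding to an edge of `M` between color classes `C_j` and `C_q`; moreover, for such
a cut gadget, the component of `r_e` is a substar of `S_e` assigned to group `G_j^q`. -/
theorem statement8
    (k n : ℕ) (hk : 2 ≤ k) (hn : 1 ≤ n)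
    (x : Fin n → ℕ) (hxinj : Function.Injective x) (hxbd : ∀ i, x i ≤ n^4)
    (hxna : ∀ (g : Fin (k-1) → Fin n) (i : Fin n),
      (∑ j, x (g j)) = (k-1) * x i → ∀ j, x (g j) = x i)
    (M : SimpleGraph (Fin k × Fin n)) (hM : ∀ u w, M.Adj u w → u.1 ≠ w.1)
    (EP : Set (Sym2 (VV k n x M))) (lam : VV k n x M → Grp k)
    (hP : IsSolutionLe (TG k n x M) EP (KK k) (sizesMCC k n x M) lam)
    (j q : Fin k) (hjq : j < q) :
    (∃! e : EIdx k n M, e.1.1.1 = j ∧ e.1.2.1 = q ∧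
        s(rootT k n x M, seRoot k n x e) ∈ EP) ∧
    (∀ e : EIdx k n M, e.1.1.1 = j → e.1.2.1 = q →
      s(rootT k n x M, seRoot k n x e) ∈ EP →
        {w | ((TG k n x M).deleteEdges EP).Reachable (seRoot k n x e) w} ⊆ SeSet k n x e ∧
        lam (seRoot k n x e) = gPair ⟨(j, q), hjq⟩) := by
  choose E hE using MCCP.exP hk hn hxbd hP
  have key : ∀ e : EIdx k n M, e.1.1.1 = j → e.1.2.1 = q →
      s(rootT k n x M, seRoot k n x e) ∈ EP → E ⟨(j, q), hjq⟩ = e := by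
    intro e h1 h2 h
    obtain ⟨pq, hpq⟩ := MCCP.uniq hk hn hxbd hP E hE e ((MCCP.mem_DD e).1 h)
    have : pq = ⟨(j, q), hjq⟩ := by
      apply Subtype.ext
      apply Prod.ext
      · rw [← (hE pq).1, hpq, h1]
      · rw [← (hE pq).2.1, hpq, h2]
    rw [← this, hpq]
  have hE' := hE ⟨(j, q), hjq⟩
  refine ⟨⟨E ⟨(j, q), hjq⟩, ⟨hE'.1, hE'.2.1, (MCCP.mem_DD _).2 hE'.2.2.1⟩, ?_⟩, ?_⟩
  · rintro e ⟨h1, h2, h3⟩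
    exact (key e h1 h2 h3).symm
  · intro e h1 h2 h3
    obtain rfl := key e h1 h2 h3
    have hsp := MCCP.sp_cut hk hn hxbd hP ⟨(j, q), hjq⟩ _ h1 h2 hE'.2.2.2
    exact ⟨MCCP.reach_sub _ hE'.2.2.1 hsp.1 hsp.2, hE'.2.2.2⟩
end

section
/- If the instance I' has a solution, then it has a solution P = (E_P, λ_P) such that for all 1 ≤ j < q ≤ k, λ_P assigns to group G_j^q a single P-component consisting of the entire star S_e of an edge-gadget T_e corresponding to an edge e of M between a vertex of color class C_j and a vertex of color class C_q. -/
open MCC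

namespace MCC

section numeric

def idx (k j q : ℕ) : ℕ := (j-1)*k - j*(j-1)/2 + q - j

lemma KK_lt (k : ℕ) (hk : 2 ≤ k) : KK k + 4 ≤ (k0 k)^2 := by
  have h1 : 1 ≤ Nat.choose k 2 := Nat.choose_pos hk
  have h2 : 3 ≤ k0 k := by unfold k0; omega
  have h3 : KK k + 4 ≤ 3 * k0 k := by unfold KK k0; omega
  nlinarith

lemma idx_aux (k j : ℕ) (hj : j + 1 ≤ k) : ∃ B : ℕ, (∀ q, j + 1 < q → idx k (j+1) q = B + (q - (j+1))) ∧
    2 * B + j * (j+1) = 2 * (j * k) := by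
  have hd : 2 ∣ (j+1)*j := by
    rw [mul_comm]; exact (Nat.even_mul_succ_self j).two_dvd
  obtain ⟨m, hm⟩ := hd
  have h1 : m ≤ j * k := by nlinarith
  refine ⟨j * k - m, ?_, ?_⟩
  · intro q hq
    unfold idx
    have : (j+1) * (j + 1 - 1) / 2 = m := by
      rw [Nat.add_sub_cancel, hm]; simp
    rw [this, Nat.add_sub_cancel]
    omega
  · have : j * (j+1) = 2 * m := by rw [← hm, mul_comm]
    omega

lemma idx_pos (k j q : ℕ) (h : j < q) (hq : q < k) : 1 ≤ idx k (j+1) (q+1) := by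
  obtain ⟨B, h1, h2⟩ := idx_aux k j (by omega)
  rw [h1 _ (by omega)]; omega

lemma idx_lt (k j q j' q' : ℕ) (h : j < q) (hq : q < k) (h' : j' < q') (hq' : q' < k)
    (hjj : j < j') : idx k (j+1) (q+1) < idx k (j'+1) (q'+1) := by
  obtain ⟨B, h1, h2⟩ := idx_aux k j (by omega)
  obtain ⟨B', h1', h2'⟩ := idx_aux k j' (by omega)
  rw [h1 _ (by omega), h1' _ (by omega)]
  have : B + (k - (j+1)) ≤ B' := by
    obtain ⟨d, rfl⟩ : ∃ d, j' = j + 1 + d := ⟨j' - (j+1), by omega⟩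
    obtain ⟨s, rfl⟩ : ∃ s, k = j + 1 + d + 1 + s := ⟨k - (j+1+d+1), by omega⟩
    have e : j + 1 + d + 1 + s - (j+1) = d + 1 + s := by omega
    rw [e]
    nlinarith [Nat.zero_le (d*d), Nat.zero_le (d*s), Nat.zero_le (d * j)]
  omega

lemma idx_inj (k j q j' q' : ℕ) (h : j < q) (hq : q < k) (h' : j' < q') (hq' : q' < k)
    (he : idx k (j+1) (q+1) = idx k (j'+1) (q'+1)) : j = j' ∧ q = q' := by
  have hjj : j = j' := by
    rcases lt_trichotomy j j' with hl | hl | hl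
    · have := idx_lt k j q j' q' h hq h' hq' hl; omega
    · exact hl
    · have := idx_lt k j' q' j q h' hq' h hq hl; omega
  subst hjj
  obtain ⟨B, h1, h2⟩ := idx_aux k j (by omega)
  rw [h1 _ (by omega), h1 _ (by omega)] at he
  exact ⟨rfl, by omega⟩

variable (k n : ℕ) (hk : 2 ≤ k) (hn : 1 ≤ n)
lemma k0_pos (hk : 2 ≤ k) : 1 ≤ k0 k := by unfold k0; omega

lemma K_lt_z (hk : 2 ≤ k) (hn : 1 ≤ n) : KK k + 4 ≤ z k n := by
  have := KK_lt k hk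
  unfold z
  have : 1 ≤ n^5 := Nat.one_le_pow _ _ hn
  nlinarith

lemma K_lt_bb (hk : 2 ≤ k) (hn : 1 ≤ n) (j : ℕ) : KK k + 4 ≤ bb k n j := by
  have := K_lt_z k n hk hn
  unfold bb
  have : 1 ≤ (k0 k)^(2*j) := Nat.one_le_pow _ _ (k0_pos k hk)
  nlinarith

lemma bb_mono (hk : 2 ≤ k) {i j : ℕ} (h : i ≤ j) : bb k n i ≤ bb k n j := by
  unfold bb
  exact Nat.mul_le_mul_right _ (Nat.pow_le_pow_right (k0_pos k hk) (by omega))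

lemma cc_mono (hk : 2 ≤ k) {i j : ℕ} (h : i ≤ j) : cc k n i ≤ cc k n j := by
  unfold cc
  exact Nat.mul_le_mul_right _ (Nat.pow_le_pow_right (k0_pos k hk) (by omega))

lemma cjq_eq (j q : ℕ) : cjq k n j q = cc k n k * ((k0 k)^2)^(idx k j q) := by
  unfold cjq idx; rw [← pow_mul]

lemma K_lt_cc (hk : 2 ≤ k) (hn : 1 ≤ n) (j : ℕ) : KK k + 4 ≤ cc k n j := by
  have := K_lt_z k n hk hn
  unfold cc
  have : 1 ≤ (k0 k)^(2*(k+j)) := Nat.one_le_pow _ _ (k0_pos k hk)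
  nlinarith

/-- fact C -/
lemma factC (hk : 2 ≤ k) (hn : 1 ≤ n) : KK k * (bb k n k + n^4) < cc k n 1 := by
  have h1 : cc k n 1 = (k0 k)^2 * bb k n k := by
    unfold cc bb; ring
  have h2 := KK_lt k hk
  have h3 : n^4 ≤ n^5 := Nat.pow_le_pow_right hn (by omega)
  have h4 : KK k * n^4 ≤ z k n := by
    unfold z; exact Nat.mul_le_mul (by omega) h3
  have h5 : z k n ≤ bb k n k := by
    unfold bb
    exact Nat.le_mul_of_pos_left _ (Nat.one_le_pow _ _ (k0_pos k hk))
  have h6 := K_lt_z k n hk hn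
  rw [h1]
  nlinarith

lemma cjq_succ (hk : 2 ≤ k) {j q j' q' : ℕ} (h : idx k j q < idx k j' q') :
    (k0 k)^2 * cjq k n j q ≤ cjq k n j' q' := by
  rw [cjq_eq, cjq_eq]
  have : (k0 k ^ 2)^(idx k j q + 1) ≤ (k0 k ^ 2)^(idx k j' q') :=
    Nat.pow_le_pow_right (Nat.one_le_pow _ _ (k0_pos k hk)) h
  calc _ = cc k n k * (k0 k ^ 2)^(idx k j q + 1) := by ring
    _ ≤ _ := Nat.mul_le_mul_left _ this

lemma cjq_ge (hk : 2 ≤ k) {j q : ℕ} (h : 1 ≤ idx k j q) :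
    (k0 k)^2 * cc k n k ≤ cjq k n j q := by
  rw [cjq_eq]
  have : (k0 k ^ 2)^1 ≤ (k0 k ^ 2)^(idx k j q) :=
    Nat.pow_le_pow_right (Nat.one_le_pow _ _ (k0_pos k hk)) h
  nlinarith

lemma factB (hk : 2 ≤ k) (hn : 1 ≤ n) {j q : ℕ} (h : 1 ≤ idx k j q) :
    KK k * cc k n k < cjq k n j q ∧ cc k n k + KK k < cjq k n j q := by
  have h1 := cjq_ge k n hk h
  have h2 := KK_lt k hk
  have h3 := K_lt_cc k n hk hn k
  constructor <;> nlinarith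

lemma factD (hk : 2 ≤ k) (hn : 1 ≤ n) {j q j' q' : ℕ} (h0 : 1 ≤ idx k j' q')
    (h : idx k j' q' < idx k j q) :
    KK k * (cjq k n j' q' + 2 * (bb k n k + n^4)) < cjq k n j q := by
  have h1 := cjq_succ k n hk h
  have h2 := KK_lt k hk
  have h3 := factC k n hk hn
  have h4 := cc_mono k n hk (show 1 ≤ k by omega)
  have h5 := (factB k n hk hn h0).2
  nlinarith

lemma factE (hk : 2 ≤ k) (hn : 1 ≤ n) {j q j' q' : ℕ} (h0 : 1 ≤ idx k j q)
    (h : idx k j q < idx k j' q') :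
    cjq k n j q + KK k < cjq k n j' q' := by
  have h1 := cjq_succ k n hk h
  have h2 := KK_lt k hk
  have h5 := (factB k n hk hn h0).2
  nlinarith

lemma cjq_le_max (hk : 2 ≤ k) (hn : 1 ≤ n) (j q : ℕ) (h : j < q) (hq : q < k) :
    cjq k n (j+1) (q+1) ≤ cjq k n (k-1) k := by
  obtain ⟨m, rfl⟩ : ∃ m, k = m + 2 := ⟨k - 2, by omega⟩
  by_cases he : j < m
  · have h1 := idx_lt (m+2) j q m (m+1) h hq (by omega) (by omega) he
    have := factE (m+2) n hk hn (idx_pos (m+2) j q h hq) h1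
    have e : m + 2 - 1 = m + 1 := rfl
    rw [e]
    have e2 : m + 1 + 1 = m + 2 := rfl
    rw [e2] at this
    omega
  · obtain rfl : j = m := by omega
    obtain rfl : q = j + 1 := by omega
    exact le_rfl

lemma cc_le_max (hk : 2 ≤ k) (hn : 1 ≤ n) (j : ℕ) (h : j < k) :
    cc k n (j+1) ≤ cjq k n (k-1) k := by
  have h1 := cjq_le_max k n hk hn 0 1 (by omega) (by omega)
  have h2 := (factB k n hk hn (idx_pos k 0 1 (by omega) (by omega))).2
  have h3 := cc_mono k n hk (show j + 1 ≤ k by omega)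
  omega

lemma card_pairs (k : ℕ) : Fintype.card {pq : Fin k × Fin k // pq.1 < pq.2} = k.choose 2 := by
  rw [Fintype.card_subtype, Finset.card_filter, Fintype.sum_prod_type_right]
  have : ∀ y : Fin k, (∑ x : Fin k, if x < y then 1 else 0) = y.1 := by
    intro y
    rw [← Finset.card_filter, ← Fin.card_Iio y]
    congr 1
    ext a
    simp
  simp only [this]
  rw [Fin.sum_univ_eq_sum_range (fun i => i), Finset.sum_range_id, Nat.choose_two_right]

end numeric

section tree

variable {k n : ℕ} {x : Fin n → ℕ} {M : SimpleGraph (Fin k × Fin n)}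

instance : Finite (EIdx k n M) := by unfold EIdx; infer_instance

/-- parent -/
def par : VV k n x M → VV k n x M
  | Sum.inl _ => rootT k n x M
  | Sum.inr (Sum.inl ⟨_, none⟩) => rootT k n x M
  | Sum.inr (Sum.inl ⟨v, some _⟩) => vgRoot k n x M v
  | Sum.inr (Sum.inr (Sum.inl ⟨_, Sum.inl none⟩)) => rootT k n x M
  | Sum.inr (Sum.inr (Sum.inl ⟨e, Sum.inl (some _)⟩)) => seRoot k n x e
  | Sum.inr (Sum.inr (Sum.inl ⟨e, Sum.inr (Sum.inl none)⟩)) => seRoot k n x e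
  | Sum.inr (Sum.inr (Sum.inl ⟨e, Sum.inr (Sum.inl (some _))⟩)) => sp1Root k n x e
  | Sum.inr (Sum.inr (Sum.inl ⟨e, Sum.inr (Sum.inr none)⟩)) => seRoot k n x e
  | Sum.inr (Sum.inr (Sum.inl ⟨e, Sum.inr (Sum.inr (some _))⟩)) => sp2Root k n x e
  | Sum.inr (Sum.inr (Sum.inr (_, none))) => rootT k n x M
  | Sum.inr (Sum.inr (Sum.inr (c, some _))) => Sum.inr (Sum.inr (Sum.inr (c, none)))

/-- depth -/
def lev : VV k n x M → ℕ
  | Sum.inl _ => 0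
  | Sum.inr (Sum.inl ⟨_, none⟩) => 1
  | Sum.inr (Sum.inl ⟨_, some _⟩) => 2
  | Sum.inr (Sum.inr (Sum.inl ⟨_, Sum.inl none⟩)) => 1
  | Sum.inr (Sum.inr (Sum.inl ⟨_, Sum.inl (some _)⟩)) => 2
  | Sum.inr (Sum.inr (Sum.inl ⟨_, Sum.inr (Sum.inl none)⟩)) => 2
  | Sum.inr (Sum.inr (Sum.inl ⟨_, Sum.inr (Sum.inl (some _))⟩)) => 3
  | Sum.inr (Sum.inr (Sum.inl ⟨_, Sum.inr (Sum.inr none)⟩)) => 2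
  | Sum.inr (Sum.inr (Sum.inl ⟨_, Sum.inr (Sum.inr (some _))⟩)) => 3
  | Sum.inr (Sum.inr (Sum.inr (_, none))) => 1
  | Sum.inr (Sum.inr (Sum.inr (_, some _))) => 2

/-- A set containing the subtree below a vertex. -/
def sub : VV k n x M → Set (VV k n x M)
  | Sum.inl _ => Set.univ
  | Sum.inr (Sum.inl ⟨v, none⟩) => Set.range (fun d => Sum.inr (Sum.inl ⟨v, d⟩))
  | Sum.inr (Sum.inr (Sum.inl ⟨e, Sum.inl none⟩)) =>
      Set.range (fun d => Sum.inr (Sum.inr (Sum.inl ⟨e, d⟩)))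
  | Sum.inr (Sum.inr (Sum.inl ⟨e, Sum.inr (Sum.inl none)⟩)) =>
      Set.range (fun d => Sum.inr (Sum.inr (Sum.inl ⟨e, Sum.inr (Sum.inl d)⟩)))
  | Sum.inr (Sum.inr (Sum.inl ⟨e, Sum.inr (Sum.inr none)⟩)) =>
      Set.range (fun d => Sum.inr (Sum.inr (Sum.inl ⟨e, Sum.inr (Sum.inr d)⟩)))
  | Sum.inr (Sum.inr (Sum.inr (c, none))) => Set.range (fun d => Sum.inr (Sum.inr (Sum.inr (c, d))))
  | w => {w}

lemma lev_par (v : VV k n x M) (hv : v ≠ rootT k n x M) : lev (par v) + 1 = lev v := by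
  rcases v with _ | ⟨v, _ | d⟩ | ⟨e, (_ | d) | (_ | d) | (_ | d)⟩ | ⟨c, _ | d⟩ <;>
    first | rfl | exact absurd rfl hv

lemma par3 (v : VV k n x M) : par (par (par v)) = rootT k n x M := by
  rcases v with _ | ⟨v, _ | d⟩ | ⟨e, (_ | d) | (_ | d) | (_ | d)⟩ | ⟨c, _ | d⟩ <;> rfl

lemma mem_sub (v : VV k n x M) : v ∈ sub v := by
  rcases v with _ | ⟨v, _ | d⟩ | ⟨e, (_ | d) | (_ | d) | (_ | d)⟩ | ⟨c, _ | d⟩ <;> simp [sub]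

lemma mem_sub1 (v : VV k n x M) : v ∈ sub (par v) := by
  rcases v with _ | ⟨v, _ | d⟩ | ⟨e, (_ | d) | (_ | d) | (_ | d)⟩ | ⟨c, _ | d⟩ <;>
    simp [sub, par, rootT, vgRoot, seRoot, sp1Root, sp2Root]

lemma mem_sub2 (v : VV k n x M) : v ∈ sub (par (par v)) := by
  rcases v with _ | ⟨v, _ | d⟩ | ⟨e, (_ | d) | (_ | d) | (_ | d)⟩ | ⟨c, _ | d⟩ <;>
    simp [sub, par, rootT, vgRoot, seRoot, sp1Root, sp2Root]

lemma adj_par (v : VV k n x M) (hv : v ≠ rootT k n x M) : (TG k n x M).Adj (par v) v := by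
  have hne : par v ≠ v := by
    intro h
    have := lev_par v hv
    rw [h] at this; omega
  refine ⟨hne, Or.inl ?_⟩
  clear hne
  rcases v with _ | ⟨v, _ | d⟩ | ⟨e, (_ | d) | (_ | d) | (_ | d)⟩ | ⟨c, _ | d⟩ <;>
    first
    | exact absurd rfl hv
    | simp [relMCC, par, rootT, vgRoot, seRoot, sp1Root, sp2Root, code, codeRel]

lemma ncard_range_le {α β : Type} [Fintype α] (f : α → β) : (Set.range f).ncard ≤ Fintype.card α := by
  rw [← Set.image_univ]
  refine (Set.ncard_image_le Set.finite_univ).trans ?_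
  simp [Set.ncard_univ]

lemma ncard_range_eq {α β : Type} [Fintype α] (f : α → β) (hf : Function.Injective f) :
    (Set.range f).ncard = Fintype.card α := by
  rw [← Set.image_univ, Set.ncard_image_of_injective _ hf]
  simp [Set.ncard_univ]

/-- Cut vertices: the parent edge is cut. -/
def WW (EP : Set (Sym2 (VV k n x M))) : Set (VV k n x M) :=
  {v | v ≠ rootT k n x M ∧ s(v, par v) ∈ EP}

lemma WW_card {EP : Set (Sym2 (VV k n x M))} : (WW EP).ncard ≤ EP.ncard := by
  refine Set.ncard_le_ncard_of_injOn (fun v => s(v, par v)) (fun v hv => hv.2) ?_ (Set.toFinite _)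
  intro v hv w hw h
  simp only [Sym2.eq_iff] at h
  rcases h with h | ⟨h1, h2⟩
  · exact h.1
  · have a := lev_par v hv.1
    have b := lev_par w hw.1
    rw [h2] at a
    rw [← h1] at b
    omega

section sol

variable {EP : Set (Sym2 (VV k n x M))} {lam : VV k n x M → Grp k}
  (hS : IsSolutionLe (TG k n x M) EP (KK k) (sizesMCC k n x M) lam)

lemma reach_par (v : VV k n x M) (hv : v ∉ WW EP) :
    ((TG k n x M).deleteEdges EP).Reachable (par v) v := by
  by_cases h : v = rootT k n x M
  · subst h; exact SimpleGraph.Reachable.refl _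
  · apply SimpleGraph.Adj.reachable
    rw [SimpleGraph.deleteEdges_adj]
    refine ⟨adj_par v h, fun h' => hv ⟨h, ?_⟩⟩
    rwa [Sym2.eq_swap]

lemma lam_par (hS : IsSolutionLe (TG k n x M) EP (KK k) (sizesMCC k n x M) lam)
    (v : VV k n x M) (hv : v ∉ WW EP) : lam v = lam (par v) :=
  (hS.2.2.1 _ _ (reach_par v hv)).symm

lemma W_le (hS : IsSolutionLe (TG k n x M) EP (KK k) (sizesMCC k n x M) lam) :
    (WW EP).ncard ≤ KK k := WW_card.trans hS.2.1

lemma lower (hS : IsSolutionLe (TG k n x M) EP (KK k) (sizesMCC k n x M) lam)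
    (S : Set (VV k n x M)) (g : Grp k) (h : ∀ v ∈ S, v ∉ WW EP → lam v = g) :
    S.ncard ≤ sizesMCC k n x M g + KK k := by
  have h1 : S ⊆ {v | lam v = g} ∪ WW EP := by
    intro v hv
    by_cases hw : v ∈ WW EP
    · exact Or.inr hw
    · exact Or.inl (h v hv hw)
  have h2 := Set.ncard_le_ncard h1 (Set.toFinite _)
  have h3 := Set.ncard_union_le {v | lam v = g} (WW EP)
  have h4 := hS.2.2.2 g
  have h5 := W_le hS
  omega

lemma sizes_le (hk : 2 ≤ k) (hn : 1 ≤ n) (g : Grp k) (hg : g ≠ gRest k) :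
    sizesMCC k n x M g ≤ cjq k n (k-1) k := by
  rcases g with j | pq | u
  · exact cc_le_max k n hk hn j.1 j.2
  · exact cjq_le_max k n hk hn _ _ pq.2 pq.1.2.2
  · exact absurd rfl hg

lemma lam_fix (hk : 2 ≤ k) (hn : 1 ≤ n)
    (hS : IsSolutionLe (TG k n x M) EP (KK k) (sizesMCC k n x M) lam) (c : Fin (KK k + 1)) :
    lam (Sum.inr (Sum.inr (Sum.inr (c, none)))) = gRest k := by
  by_contra hg
  have h1 := sizes_le (x := x) (M := M) hk hn _ hg
  have h2 := lower hS (Set.range (fun d => Sum.inr (Sum.inr (Sum.inr (c, d)))))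
    (lam (Sum.inr (Sum.inr (Sum.inr (c, none))))) (by
      rintro _ ⟨d, rfl⟩ hd
      rcases d with _ | d
      · rfl
      · exact lam_par hS _ hd)
  rw [ncard_range_eq _ (by intro a b h; simpa using h)] at h2
  simp only [Fintype.card_option, Fintype.card_fin] at h2
  have : fixSize k n = cjq k n (k-1) k + KK k + 1 := rfl
  omega

lemma lam_root (hk : 2 ≤ k) (hn : 1 ≤ n)
    (hS : IsSolutionLe (TG k n x M) EP (KK k) (sizesMCC k n x M) lam) :
    lam (rootT k n x M) = gRest k := by
  by_contra hg
  have h1 : Set.range (fun c : Fin (KK k + 1) =>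
      (Sum.inr (Sum.inr (Sum.inr (c, none))) : VV k n x M)) ⊆ WW EP := by
    rintro _ ⟨c, rfl⟩
    by_contra hc
    have := lam_par hS _ hc
    rw [lam_fix hk hn hS c] at this
    exact hg this.symm
  have h2 := Set.ncard_le_ncard h1 (Set.toFinite _)
  rw [ncard_range_eq _ (by intro a b h; simpa using h), Fintype.card_fin] at h2
  have := W_le hS
  omega

lemma exists_big (hk : 2 ≤ k) (hn : 1 ≤ n)
    (hS : IsSolutionLe (TG k n x M) EP (KK k) (sizesMCC k n x M) lam) (g : Grp k)
    (hg : g ≠ gRest k) (hpos : 0 < sizesMCC k n x M g) :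
    ∃ w ∈ WW EP, lam w = g ∧ sizesMCC k n x M g ≤ KK k * (sub w).ncard := by
  classical
  by_contra hcon
  push Not at hcon
  have hfin : (WW EP ∩ {v | lam v = g}).Finite := Set.toFinite _
  have hsub : {v | lam v = g} ⊆ ⋃ w ∈ hfin.toFinset, sub w := by
    intro v hv
    simp only [Set.mem_iUnion, Set.Finite.mem_toFinset]
    have hv' : lam v = g := hv
    by_cases h0 : v ∈ WW EP
    · exact ⟨v, ⟨h0, hv⟩, mem_sub v⟩
    have e0 := lam_par hS v h0
    by_cases h1 : par v ∈ WW EP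
    · exact ⟨par v, ⟨h1, e0.symm.trans hv'⟩, mem_sub1 v⟩
    have e1 := lam_par hS _ h1
    by_cases h2 : par (par v) ∈ WW EP
    · exact ⟨par (par v), ⟨h2, (e0.trans e1).symm.trans hv'⟩, mem_sub2 v⟩
    have e2 := lam_par hS _ h2
    rw [par3, lam_root hk hn hS] at e2
    exact absurd (hv'.symm.trans (e0.trans (e1.trans e2))) hg
  have h1 := Set.ncard_le_ncard hsub (Set.toFinite _)
  rw [hS.2.2.2 g] at h1
  have h2 : (⋃ w ∈ hfin.toFinset, sub w).ncard ≤ ∑ w ∈ hfin.toFinset, (sub w).ncard :=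
    Finset.set_ncard_biUnion_le _ _
  have h3 : hfin.toFinset.card ≤ KK k := by
    rw [← Set.ncard_eq_toFinset_card _ hfin]
    exact (Set.ncard_le_ncard Set.inter_subset_left (Set.toFinite _)).trans (W_le hS)
  have hne : hfin.toFinset.Nonempty := by
    by_contra hne
    rw [Finset.not_nonempty_iff_eq_empty] at hne
    rw [hne] at h2
    simp at h2
    rw [hne] at h1
    simp at h1
    omega
  have h4 : ∑ w ∈ hfin.toFinset, KK k * (sub w).ncard <
      ∑ w ∈ hfin.toFinset, sizesMCC k n x M g := by
    refine Finset.sum_lt_sum_of_nonempty hne ?_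
    intro w hw
    rw [Set.Finite.mem_toFinset] at hw
    exact hcon w hw.1 hw.2
  rw [← Finset.mul_sum, Finset.sum_const, smul_eq_mul] at h4
  have h5 : KK k * sizesMCC k n x M g ≤ KK k * ∑ w ∈ hfin.toFinset, (sub w).ncard :=
    Nat.mul_le_mul_left _ (h1.trans h2)
  have h6 : hfin.toFinset.card * sizesMCC k n x M g ≤ KK k * sizesMCC k n x M g :=
    Nat.mul_le_mul_right _ h3
  omega

lemma seSize_pos (hk : 2 ≤ k) (hn : 1 ≤ n) (e : EIdx k n M) : 1 ≤ seSize k n e := by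
  have := (factB k n hk hn (idx_pos k _ _ e.2.2 e.1.2.1.2)).2
  unfold seSize; omega

lemma spSize_pos (hk : 2 ≤ k) (hn : 1 ≤ n) (v : Fin k × Fin n) :
    KK k + 4 ≤ spSize k n x v := by
  have := K_lt_bb k n hk hn (v.1.1 + 1)
  unfold spSize; omega

lemma spSize_le (hk : 2 ≤ k) (hxbd : ∀ i, x i ≤ n^4) (v : Fin k × Fin n) :
    spSize k n x v ≤ bb k n k + n^4 := by
  have := bb_mono k n hk (show v.1.1 + 1 ≤ k from v.1.2)
  have := hxbd v.2
  unfold spSize; omega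

lemma SeSet_eq (e : EIdx k n M) : SeSet k n x e = Set.range (fun d => (Sum.inr (Sum.inr (Sum.inl ⟨e, Sum.inl d⟩)) : VV k n x M)) := by
  ext w
  constructor
  · rintro ⟨d, h⟩; exact ⟨d, h.symm⟩
  · rintro ⟨d, h⟩; exact ⟨d, h.symm⟩

lemma SeSet_card (hk : 2 ≤ k) (hn : 1 ≤ n) (e : EIdx k n M) :
    (SeSet k n x e).ncard = seSize k n e := by
  have := seSize_pos hk hn e
  rw [SeSet_eq, ncard_range_eq _ (by intro a b h; simpa using h)]
  simp only [Fintype.card_option, Fintype.card_fin]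
  omega

lemma Se_lower (hk : 2 ≤ k) (hn : 1 ≤ n)
    (hS : IsSolutionLe (TG k n x M) EP (KK k) (sizesMCC k n x M) lam) (e : EIdx k n M) :
    seSize k n e ≤ sizesMCC k n x M (lam (seRoot k n x e)) + KK k := by
  rw [← SeSet_card (x := x) hk hn e]
  refine lower hS _ _ ?_
  rintro _ ⟨d, rfl⟩ hd
  rcases d with _ | d
  · rfl
  · exact lam_par hS _ hd

lemma sp1_cut (hk : 2 ≤ k) (hn : 1 ≤ n)
    (hS : IsSolutionLe (TG k n x M) EP (KK k) (sizesMCC k n x M) lam) (e : EIdx k n M)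
    (he : sizesMCC k n x M (lam (seRoot k n x e)) = seSize k n e) :
    sp1Root k n x e ∈ WW EP := by
  by_contra hc
  have hc' := lam_par hS _ hc
  have h := lower hS (Set.range (fun d : Option (Fin (seSize k n e - 1)) ⊕ Option (Fin (spSize k n x e.1.1 - 1)) =>
    (Sum.inr (Sum.inr (Sum.inl ⟨e, d.elim Sum.inl (fun d => Sum.inr (Sum.inl d))⟩)) : VV k n x M)))
    (lam (seRoot k n x e)) (by
      rintro _ ⟨(_ | d) | (_ | d), rfl⟩ hd
      · rfl
      · exact lam_par hS _ hd
      · exact hc'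
      · exact (lam_par hS _ hd).trans hc')
  rw [ncard_range_eq _ (by rintro (a | a) (b | b) h <;> simp at h <;> simp [h])] at h
  simp only [Fintype.card_sum, Fintype.card_option, Fintype.card_fin] at h
  have h1 := seSize_pos hk hn e
  have h2 := spSize_pos (x := x) hk hn e.1.1
  omega

lemma sp2_cut (hk : 2 ≤ k) (hn : 1 ≤ n)
    (hS : IsSolutionLe (TG k n x M) EP (KK k) (sizesMCC k n x M) lam) (e : EIdx k n M)
    (he : sizesMCC k n x M (lam (seRoot k n x e)) = seSize k n e) :
    sp2Root k n x e ∈ WW EP := by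
  by_contra hc
  have hc' := lam_par hS _ hc
  have h := lower hS (Set.range (fun d : Option (Fin (seSize k n e - 1)) ⊕ Option (Fin (spSize k n x e.1.2 - 1)) =>
    (Sum.inr (Sum.inr (Sum.inl ⟨e, d.elim Sum.inl (fun d => Sum.inr (Sum.inr d))⟩)) : VV k n x M)))
    (lam (seRoot k n x e)) (by
      rintro _ ⟨(_ | d) | (_ | d), rfl⟩ hd
      · rfl
      · exact lam_par hS _ hd
      · exact hc'
      · exact (lam_par hS _ hd).trans hc')
  rw [ncard_range_eq _ (by rintro (a | a) (b | b) h <;> simp at h <;> simp [h])] at h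
  simp only [Fintype.card_sum, Fintype.card_option, Fintype.card_fin] at h
  have h1 := seSize_pos hk hn e
  have h2 := spSize_pos (x := x) hk hn e.1.2
  omega

/-- Classification of cut vertices in a non-rest group. -/
lemma classify (hk : 2 ≤ k) (hn : 1 ≤ n) (hxbd : ∀ i, x i ≤ n^4)
    (hS : IsSolutionLe (TG k n x M) EP (KK k) (sizesMCC k n x M) lam) (w : VV k n x M)
    (hw : w ∈ WW EP) (hl : lam w ≠ gRest k) :
    (sub w).ncard ≤ bb k n k + n^4 ∨
    (∃ v, w = vgRoot k n x M v ∧ (sub w).ncard ≤ cc k n k) ∨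
    (∃ e, w = seRoot k n x e ∧ (sub w).ncard ≤ seSize k n e + 2 * (bb k n k + n^4)) := by
  have hb := K_lt_bb k n hk hn k
  have hc := K_lt_cc k n hk hn k
  rcases w with u | ⟨v, _ | d⟩ | ⟨e, (_ | d) | (_ | d) | (_ | d)⟩ | ⟨c, _ | d⟩
  · exact absurd rfl hw.1
  · refine Or.inr (Or.inl ⟨v, rfl, ?_⟩)
    refine (ncard_range_le _).trans ?_
    simp only [Fintype.card_option, Fintype.card_fin]
    have : vgSize k n x v ≤ cc k n (v.1.1 + 1) := by
      unfold vgSize; omega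
    have := cc_mono k n hk (show v.1.1 + 1 ≤ k from v.1.2)
    omega
  · left; simp only [sub, Set.ncard_singleton]; omega
  · refine Or.inr (Or.inr ⟨e, rfl, ?_⟩)
    refine (ncard_range_le _).trans ?_
    simp only [Fintype.card_sum, Fintype.card_option, Fintype.card_fin]
    have h1 := seSize_pos hk hn e
    have h2 := spSize_pos (x := x) hk hn e.1.1
    have h3 := spSize_pos (x := x) hk hn e.1.2
    have h4 := spSize_le hk hxbd e.1.1
    have h5 := spSize_le hk hxbd e.1.2
    omega
  · left; simp only [sub, Set.ncard_singleton]; omega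
  · left
    refine (ncard_range_le _).trans ?_
    simp only [Fintype.card_option, Fintype.card_fin]
    have h2 := spSize_pos (x := x) hk hn e.1.1
    have h4 := spSize_le hk hxbd e.1.1
    omega
  · left; simp only [sub, Set.ncard_singleton]; omega
  · left
    refine (ncard_range_le _).trans ?_
    simp only [Fintype.card_option, Fintype.card_fin]
    have h2 := spSize_pos (x := x) hk hn e.1.2
    have h4 := spSize_le hk hxbd e.1.2
    omega
  · left; simp only [sub, Set.ncard_singleton]; omega
  · exact absurd (lam_fix hk hn hS c) hl
  · left; simp only [sub, Set.ncard_singleton]; omega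

lemma col_cut (hk : 2 ≤ k) (hn : 1 ≤ n) (hxbd : ∀ i, x i ≤ n^4)
    (hS : IsSolutionLe (TG k n x M) EP (KK k) (sizesMCC k n x M) lam) (j : Fin k) :
    ∃ v, vgRoot k n x M v ∈ WW EP ∧ lam (vgRoot k n x M v) = gCol j := by
  have hsz : sizesMCC k n x M (gCol j) = cc k n (j.1 + 1) := rfl
  have hne : (gCol j : Grp k) ≠ gRest k := by simp [gCol, gRest]
  have hp := K_lt_cc k n hk hn (j.1 + 1)
  obtain ⟨w, hw, hl, hs⟩ := exists_big hk hn hS (gCol j) hne (by omega)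
  rw [hsz] at hs
  rcases classify hk hn hxbd hS w hw (by rw [hl]; exact hne) with h | ⟨v, rfl, h⟩ | ⟨e, rfl, h⟩
  · have h1 := factC k n hk hn
    have h2 := cc_mono k n hk (show 1 ≤ j.1 + 1 by omega)
    have h3 := Nat.mul_le_mul_left (KK k) h
    omega
  · exact ⟨v, hw, hl⟩
  · have h1 := Se_lower hk hn hS e
    rw [hl, hsz] at h1
    have h2 := (factB k n hk hn (idx_pos k _ _ e.2.2 e.1.2.1.2)).2
    have h3 := cc_mono k n hk (show j.1 + 1 ≤ k from j.2)
    unfold seSize at h1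
    omega

lemma pair_cut (hk : 2 ≤ k) (hn : 1 ≤ n) (hxbd : ∀ i, x i ≤ n^4)
    (hS : IsSolutionLe (TG k n x M) EP (KK k) (sizesMCC k n x M) lam)
    (pq : {pq : Fin k × Fin k // pq.1 < pq.2}) :
    ∃ e : EIdx k n M, e.1.1.1 = pq.1.1 ∧ e.1.2.1 = pq.1.2 ∧ seRoot k n x e ∈ WW EP ∧
      lam (seRoot k n x e) = gPair pq := by
  have hsz : sizesMCC k n x M (gPair pq) = cjq k n (pq.1.1.1 + 1) (pq.1.2.1 + 1) := rfl
  have hne : (gPair pq : Grp k) ≠ gRest k := by simp [gPair, gRest]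
  have hi := idx_pos k _ _ pq.2 pq.1.2.2
  have hp := factB k n hk hn hi
  obtain ⟨w, hw, hl, hs⟩ := exists_big hk hn hS (gPair pq) hne (by omega)
  rw [hsz] at hs
  rcases classify hk hn hxbd hS w hw (by rw [hl]; exact hne) with h | ⟨v, rfl, h⟩ | ⟨e, rfl, h⟩
  · have h1 := factC k n hk hn
    have h2 := cc_mono k n hk (show 1 ≤ k by omega)
    have h3 := Nat.mul_le_mul_left (KK k) h
    omega
  · have h3 := Nat.mul_le_mul_left (KK k) h
    omega
  · have hi' := idx_pos k _ _ e.2.2 e.1.2.1.2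
    have h1 := Se_lower hk hn hS e
    rw [hl, hsz] at h1
    have h3 := Nat.mul_le_mul_left (KK k) h
    unfold seSize at h1 h3
    rcases lt_trichotomy (idx k (e.1.1.1.1 + 1) (e.1.2.1.1 + 1))
      (idx k (pq.1.1.1 + 1) (pq.1.2.1 + 1)) with hlt | heq | hgt
    · have := factD k n hk hn hi' hlt
      omega
    · obtain ⟨a, b⟩ := idx_inj k _ _ _ _ e.2.2 e.1.2.1.2 pq.2 pq.1.2.2 heq
      exact ⟨e, Fin.ext a, Fin.ext b, hw, hl⟩
    · have := factE k n hk hn hi hgt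
      omega

end sol
end tree
end MCC

/-- If the instance `I'` has a solution, then it has a solution `P` such that for all
`j < q`, group `G_j^q` consists of a single `P`-component, namely the entire star `S_e`
of an edge-gadget `T_e` corresponding to an edge of `M` between color classes `C_j`
and `C_q`. -/
theorem statement9
    (k n : ℕ) (hk : 2 ≤ k) (hn : 1 ≤ n)
    (x : Fin n → ℕ) (hxinj : Function.Injective x) (hxbd : ∀ i, x i ≤ n^4)
    (hxna : ∀ (g : Fin (k-1) → Fin n) (i : Fin n),
      (∑ j, x (g j)) = (k-1) * x i → ∀ j, x (g j) = x i)
    (M : SimpleGraph (Fin k × Fin n)) (hM : ∀ u w, M.Adj u w → u.1 ≠ w.1)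
    (hsol : HasSol k n x M) :
    ∃ (EP : Set (Sym2 (VV k n x M))) (lam : VV k n x M → Grp k),
      IsSolutionLe (TG k n x M) EP (KK k) (sizesMCC k n x M) lam ∧
      ∀ (j q : Fin k) (hjq : j < q),
        ∃ e : EIdx k n M, e.1.1.1 = j ∧ e.1.2.1 = q ∧
          IsPComp (TG k n x M) EP (SeSet k n x e) ∧
          {v | lam v = gPair ⟨(j, q), hjq⟩} = SeSet k n x e := by
  obtain ⟨EP, lam, hS⟩ := hsol
  refine ⟨EP, lam, hS, ?_⟩
  choose v hvW hvl using col_cut hk hn hxbd hS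
  choose e he1 he2 heW hel using pair_cut hk hn hxbd hS
  have hsz : ∀ pq, seSize k n (e pq) = sizesMCC k n x M (gPair pq) := by
    intro pq
    simp only [seSize, sizesMCC, gPair, he1, he2]
  have hinj : Function.Injective e := by
    intro a b h
    apply Subtype.ext
    apply Prod.ext
    · rw [← he1, ← he1, h]
    · rw [← he2, ← he2, h]
  have hvinj : Function.Injective v := by
    intro a b h
    have : (gCol a : Grp k) = gCol b := by rw [← hvl, ← hvl, h]
    simpa [gCol] using this
  let P := {pq : Fin k × Fin k // pq.1 < pq.2}
  let F : Fin k ⊕ P ⊕ P ⊕ P → VV k n x M := fun s => match s with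
    | Sum.inl j => vgRoot k n x M (v j)
    | Sum.inr (Sum.inl p) => seRoot k n x (e p)
    | Sum.inr (Sum.inr (Sum.inl p)) => sp1Root k n x (e p)
    | Sum.inr (Sum.inr (Sum.inr p)) => sp2Root k n x (e p)
  have hFinj : Function.Injective F := by
    rintro (a | a | a | a) (b | b | b | b) h <;>
      simp [F, vgRoot, seRoot, sp1Root, sp2Root] at h ⊢
    · exact hvinj h.1
    all_goals
      obtain ⟨h1, h2⟩ := h
      have h3 := hinj h1
      subst h3
      first | rfl | simp at h2
  have hFsub : Set.range F ⊆ WW EP := by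
    rintro _ ⟨a | a | a | a, rfl⟩
    · exact hvW a
    · exact heW a
    · exact sp1_cut hk hn hS _ (by rw [hel, hsz])
    · exact sp2_cut hk hn hS _ (by rw [hel, hsz])
  have hFW : Set.range F = WW EP := by
    refine Set.eq_of_subset_of_ncard_le hFsub ?_ (Set.toFinite _)
    refine (W_le hS).trans ?_
    rw [ncard_range_eq F hFinj]
    simp only [Fintype.card_sum, Fintype.card_fin, P, card_pairs, KK]
    omega
  intro j q hjq
  set pq : P := ⟨(j, q), hjq⟩ with hpq
  have hreach : ∀ w ∈ SeSet k n x (e pq),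
      ((TG k n x M).deleteEdges EP).Reachable (seRoot k n x (e pq)) w := by
    rintro _ ⟨_ | d, rfl⟩
    · exact SimpleGraph.Reachable.refl _
    · refine reach_par (Sum.inr (Sum.inr (Sum.inl ⟨e pq, Sum.inl (some d)⟩)) : VV k n x M) ?_
      rw [← hFW]
      rintro ⟨a | a | a | a, h⟩ <;> simp [F, vgRoot, seRoot, sp1Root, sp2Root] at h
      all_goals
        obtain ⟨h1, h2⟩ := h
        have h3 := hinj h1
        subst h3
        simp at h2
  have hcls : SeSet k n x (e pq) = {w | lam w = gPair pq} := by
    refine Set.eq_of_subset_of_ncard_le ?_ ?_ (Set.toFinite _)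
    · intro w hw
      exact (hS.2.2.1 _ _ (hreach w hw)).symm.trans (hel pq)
    · rw [SeSet_card hk hn, hsz, hS.2.2.2]
  refine ⟨e pq, he1 pq, he2 pq, ⟨seRoot k n x (e pq), ?_⟩, hcls.symm⟩
  apply Set.Subset.antisymm
  · exact hreach
  · intro w hw
    rw [hcls]
    exact (hS.2.2.1 _ _ hw).symm.trans (hel pq)
end
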